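/- Let Δ be a simplicial complex on [n] with dim Δ ≥ 2. The following conditions are equivalent: (i) I_Δ^m is Cohen–Macaulay for every m ≥ 1; (ii) I_Δ^m is Buchsbaum for some m ≥ 3; (iii) I_Δ^m is quasi-Buchsbaum for some m ≥ 3; (iv) Δ is a complete intersection. -/

import Mathlib

open CategoryTheory Opposite

/-! ### Abstract simplicial complexes -/

/-- An abstract simplicial complex on the vertex set `Fin n`: a collection of finite
subsets (faces) closed under taking subsets. -/
structure SimComplex (n : ℕ) where
  faces : Set (Finset (Fin n))
  down_closed : ∀ ⦃F G : Finset (Fin n)⦄, F ∈ faces → G ⊆ F → G ∈ faces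

namespace SimComplex

variable {n : ℕ}

/-- The vertex set of a simplicial complex. -/
def vertexSet (Δ : SimComplex n) : Set (Fin n) := {v | ({v} : Finset (Fin n)) ∈ Δ.faces}

/-- The dimension of a simplicial complex: the maximal cardinality of a face, minus one. -/
noncomputable def dim (Δ : SimComplex n) : ℤ :=
  (Int.ofNat (sSup (Finset.card '' Δ.faces))) - 1

/-- A facet is a maximal face. -/
def IsFacet (Δ : SimComplex n) (F : Finset (Fin n)) : Prop :=
  F ∈ Δ.faces ∧ ∀ G ∈ Δ.faces, F ⊆ G → F = G

/-- A complex is pure if all facets have the same cardinality. -/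
def Pure (Δ : SimComplex n) : Prop :=
  ∀ F G, Δ.IsFacet F → Δ.IsFacet G → F.card = G.card

/-- A matroid: for any two faces `F`, `G` with `|F| > |G|` there is `i ∈ F ∖ G`
with `G ∪ {i}` a face. -/
def IsMatroid (Δ : SimComplex n) : Prop :=
  ∀ F G, F ∈ Δ.faces → G ∈ Δ.faces → G.card < F.card →
    ∃ i ∈ F, i ∉ G ∧ insert i G ∈ Δ.faces

/-- The link of a face `G`: `{F ∖ G : G ⊆ F ∈ Δ}`. -/
def link (Δ : SimComplex n) (G : Finset (Fin n)) : SimComplex n where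
  faces := {F | Disjoint F G ∧ F ∪ G ∈ Δ.faces}
  down_closed := by
    intro F F' hF hsub
    exact ⟨hF.1.mono_left hsub, Δ.down_closed hF.2 (Finset.union_subset_union hsub subset_rfl)⟩

/-- The star of a face `G`: `{F ∈ Δ : F ∪ G ∈ Δ}`. -/
def star (Δ : SimComplex n) (G : Finset (Fin n)) : SimComplex n where
  faces := {F | F ∈ Δ.faces ∧ F ∪ G ∈ Δ.faces}
  down_closed := by
    intro F F' hF hsub
    exact ⟨Δ.down_closed hF.1 hsub, Δ.down_closed hF.2 (Finset.union_subset_union hsub subset_rfl)⟩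

/-- `Δ` is locally a matroid if the link of every vertex is a matroid. -/
def LocallyMatroid (Δ : SimComplex n) : Prop :=
  ∀ v ∈ Δ.vertexSet, (Δ.link {v}).IsMatroid

/-- Two vertices are adjacent if they span a 1-dimensional face (an edge). -/
def Adj (Δ : SimComplex n) (u v : Fin n) : Prop :=
  u ≠ v ∧ ({u, v} : Finset (Fin n)) ∈ Δ.faces

/-- Two vertices are joined by a path of edges. -/
def Reach (Δ : SimComplex n) : Fin n → Fin n → Prop := Relation.ReflTransGen Δ.Adj

/-- A complex is connected if any two vertices are joined by a path of edges. -/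
def Connected (Δ : SimComplex n) : Prop :=
  ∀ u ∈ Δ.vertexSet, ∀ v ∈ Δ.vertexSet, Δ.Reach u v

/-- The induced subcomplex on a set `W` of vertices. -/
def induced (Δ : SimComplex n) (W : Set (Fin n)) : SimComplex n where
  faces := {F | F ∈ Δ.faces ∧ ↑F ⊆ W}
  down_closed := by
    intro F F' hF hsub
    exact ⟨Δ.down_closed hF.1 hsub, subset_trans (Finset.coe_subset.2 hsub) hF.2⟩

/-- The connected component of a vertex `v`, as an induced subcomplex. -/
def component (Δ : SimComplex n) (v : Fin n) : SimComplex n :=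
  Δ.induced {u | Δ.Reach v u}

/-- A minimal nonface: a subset of the vertex set which is not a face, all of whose
proper subsets are faces. -/
def IsMinNonface (Δ : SimComplex n) (F : Finset (Fin n)) : Prop :=
  ↑F ⊆ Δ.vertexSet ∧ F ∉ Δ.faces ∧ ∀ G ⊂ F, G ∈ Δ.faces

/-- A complete intersection complex: the minimal nonfaces are pairwise disjoint. -/
def IsCompleteIntersection (Δ : SimComplex n) : Prop :=
  ∀ F G, Δ.IsMinNonface F → Δ.IsMinNonface G → F ≠ G → Disjoint F G

/-- `Δ` is locally a complete intersection if the link of every vertex is one. -/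
def LocallyCompleteIntersection (Δ : SimComplex n) : Prop :=
  ∀ v ∈ Δ.vertexSet, (Δ.link {v}).IsCompleteIntersection

/-- A path graph: vertices `f 0, …, f (k+1)` and edges exactly the consecutive pairs. -/
def IsPathGraph (Δ : SimComplex n) : Prop :=
  ∃ (k : ℕ) (f : Fin (k + 2) → Fin n), Function.Injective f ∧
    Δ.vertexSet = Set.range f ∧
    ∀ e : Finset (Fin n), (e ∈ Δ.faces ∧ e.card = 2) ↔
      ∃ i : Fin (k + 1), e = {f i.castSucc, f i.succ}

/-- A cycle graph: vertices `f 0, …, f (k+2)` and edges exactly the cyclically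
consecutive pairs. -/
def IsCycleGraph (Δ : SimComplex n) : Prop :=
  ∃ (k : ℕ) (f : Fin (k + 3) → Fin n), Function.Injective f ∧
    Δ.vertexSet = Set.range f ∧
    ∀ e : Finset (Fin n), (e ∈ Δ.faces ∧ e.card = 2) ↔
      ∃ i : Fin (k + 3), e = {f i, f (i + 1)}

end SimComplex

/-! ### Commutative-algebra notions -/

noncomputable section

/-- The `i`-th Ext group of two modules over a commutative ring. -/
def ExtGroup (A : Type) [CommRing A] (i : ℕ) (M N : Type) [AddCommGroup M] [Module A M]
    [AddCommGroup N] [Module A N] : Type :=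
  ((Ext A (ModuleCat A) i).obj (op (ModuleCat.of A M))).obj (ModuleCat.of A N)

/-- A local ring is Cohen–Macaulay if its depth equals its Krull dimension, i.e. if
`Ext^i(residue field, B)` vanishes for all `i < dim B`. -/
def IsCohenMacaulayLocalRing (B : Type) [CommRing B] [IsLocalRing B] : Prop :=
  ∀ i : ℕ, (i : WithBot ℕ∞) < ringKrullDim B →
    Subsingleton (ExtGroup B i (B ⧸ IsLocalRing.maximalIdeal B) B)

/-- A commutative ring is Cohen–Macaulay if all its localizations at primes are
Cohen–Macaulay local rings. -/
def IsCohenMacaulayRing (A : Type) [CommRing A] : Prop :=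
  ∀ (P : Ideal A) (hP : P.IsPrime),
    letI : P.IsPrime := hP
    IsCohenMacaulayLocalRing (Localization.AtPrime P)

/-- An ideal `I` of `A` is Cohen–Macaulay if `A ⧸ I` is a Cohen–Macaulay ring. -/
def IsCohenMacaulayIdeal {A : Type} [CommRing A] (I : Ideal A) : Prop :=
  IsCohenMacaulayRing (A ⧸ I)

/-- The ideal `I` satisfies Serre's condition `(S₂)`: for every prime `P` of `A`, the
depth of the localized module `(A⧸I)_P` over `A_P` is at least `min {2, height P}`,
where the height of `P` is the Krull dimension of `A_P` and depth is detected by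
vanishing of `Ext^i` from the residue field. -/
def SatisfiesS2 {A : Type} [CommRing A] (I : Ideal A) : Prop :=
  ∀ (P : Ideal A) (hP : P.IsPrime),
    letI : P.IsPrime := hP
    ∀ i : ℕ, (i : WithBot ℕ∞) < min 2 (ringKrullDim (Localization.AtPrime P)) →
      Subsingleton (ExtGroup (Localization.AtPrime P) i
        (Localization.AtPrime P ⧸ IsLocalRing.maximalIdeal (Localization.AtPrime P))
        (LocalizedModule P.primeCompl (A ⧸ I)))

/-- The `m`-th symbolic power of an ideal: the intersection of the `m`-th powers of
its minimal primes. -/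
def symbPowIdeal {A : Type} [CommRing A] (I : Ideal A) (m : ℕ) : Ideal A :=
  ⨅ P ∈ I.minimalPrimes, P ^ m

end

/-! ### Stanley–Reisner theory -/

noncomputable section

open MvPolynomial

/-- The squarefree monomial attached to a finite set of variables. -/
def faceMonomial (K : Type) [Field K] {n : ℕ} (F : Finset (Fin n)) : MvPolynomial (Fin n) K :=
  ∏ i ∈ F, X i

/-- The Stanley–Reisner ideal of a complex on `[n]`: generated by the squarefree
monomials corresponding to nonfaces. -/
def SRIdeal (K : Type) [Field K] {n : ℕ} (Δ : SimComplex n) : Ideal (MvPolynomial (Fin n) K) :=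
  Ideal.span {p | ∃ F : Finset (Fin n), F ∉ Δ.faces ∧ p = faceMonomial K F}

/-- The Stanley–Reisner ideal of a complex whose vertex set may be a proper subset of
`[n]`: generated by the squarefree monomials of nonfaces contained in the vertex set. -/
def SRIdealOn (K : Type) [Field K] {n : ℕ} (Δ : SimComplex n) : Ideal (MvPolynomial (Fin n) K) :=
  Ideal.span {p | ∃ F : Finset (Fin n), ↑F ⊆ Δ.vertexSet ∧ F ∉ Δ.faces ∧ p = faceMonomial K F}

/-- The prime ideal generated by the variables indexed by `F`. -/
def PF (K : Type) [Field K] {n : ℕ} (F : Finset (Fin n)) : Ideal (MvPolynomial (Fin n) K) :=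
  Ideal.span ((fun i => (X i : MvPolynomial (Fin n) K)) '' ↑F)

/-- The `m`-th symbolic power of the Stanley–Reisner ideal:
`I_Δ^{(m)} = ⋂_{F facet} P_{complement of F}^m`. -/
def SRSymbPow (K : Type) [Field K] {n : ℕ} (Δ : SimComplex n) (m : ℕ) :
    Ideal (MvPolynomial (Fin n) K) :=
  ⨅ (F : Finset (Fin n)) (_ : Δ.IsFacet F), (PF K Fᶜ) ^ m

/-- The cover ideal `J(Δ) = ⋂_{F facet} P_F` and its symbolic powers. -/
def coverSymbPow (K : Type) [Field K] {n : ℕ} (Δ : SimComplex n) (m : ℕ) :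
    Ideal (MvPolynomial (Fin n) K) :=
  ⨅ (F : Finset (Fin n)) (_ : Δ.IsFacet F), (PF K F) ^ m

/-- The graded maximal ideal `(x_1, …, x_n)`. -/
def maxIdeal (K : Type) [Field K] (n : ℕ) : Ideal (MvPolynomial (Fin n) K) :=
  Ideal.span (Set.range X)

/-- The `i`-th local cohomology module of `S ⧸ I` with support in the maximal
graded ideal. -/
def locCoh (K : Type) [Field K] {n : ℕ} (i : ℕ) (I : Ideal (MvPolynomial (Fin n) K)) :
    ModuleCat (MvPolynomial (Fin n) K) :=
  (localCohomology (maxIdeal K n) i).obj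
    (ModuleCat.of (MvPolynomial (Fin n) K) (MvPolynomial (Fin n) K ⧸ I))

/-- `I` is quasi-Buchsbaum: the maximal ideal annihilates all local cohomology modules
`H^i_m(S⧸I)` for `i < dim S⧸I`. -/
def IsQuasiBuchsbaum (K : Type) [Field K] {n : ℕ} (I : Ideal (MvPolynomial (Fin n) K)) : Prop :=
  ∀ i : ℕ, (i : WithBot ℕ∞) < ringKrullDim (MvPolynomial (Fin n) K ⧸ I) →
    ∀ x ∈ maxIdeal K n, ∀ y : (locCoh K i I), x • y = 0

/-- `I` is Buchsbaum: for `i < dim S⧸I` the natural map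
`Ext^i_S(S⧸m, S⧸I) → H^i_m(S⧸I)` (the structure map into the direct limit defining local
cohomology) is surjective. -/
def IsBuchsbaum (K : Type) [Field K] {n : ℕ} (I : Ideal (MvPolynomial (Fin n) K)) : Prop :=
  ∀ i : ℕ, (i : WithBot ℕ∞) < ringKrullDim (MvPolynomial (Fin n) K ⧸ I) →
    letI := localCohomology.hasColimitDiagram
      (localCohomology.idealPowersDiagram (maxIdeal K n)) i
    Function.Surjective
      ((CategoryTheory.Limits.colimit.ι
          (localCohomology.diagram (localCohomology.idealPowersDiagram (maxIdeal K n)) i)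
          (Opposite.op (Opposite.op (1 : ℕ)))).app
        (ModuleCat.of (MvPolynomial (Fin n) K) (MvPolynomial (Fin n) K ⧸ I)))

/-- `I` is generalized Cohen–Macaulay: the local cohomology modules `H^i_m(S⧸I)` are
finite-dimensional over `K` for `i < dim S⧸I`. -/
def IsGeneralizedCM (K : Type) [Field K] {n : ℕ} (I : Ideal (MvPolynomial (Fin n) K)) : Prop :=
  ∀ i : ℕ, (i : WithBot ℕ∞) < ringKrullDim (MvPolynomial (Fin n) K ⧸ I) →
    Module.Finite K (RestrictScalars K (MvPolynomial (Fin n) K) (locCoh K i I))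

end

/-! ### Monomial ideals -/

/-- A monomial ideal of `K[x_1,…,x_n]`. -/
def IsMonomialIdeal {K : Type} [Field K] {n : ℕ} (I : Ideal (MvPolynomial (Fin n) K)) : Prop :=
  ∃ S : Set (Fin n →₀ ℕ),
    I = Ideal.span {p | ∃ d ∈ S, p = MvPolynomial.monomial d (1 : K)}

/-- A squarefree monomial ideal of `K[x_1,…,x_n]`. -/
def IsSquarefreeMonomialIdeal {K : Type} [Field K] {n : ℕ}
    (I : Ideal (MvPolynomial (Fin n) K)) : Prop :=
  ∃ S : Set (Finset (Fin n)),
    I = Ideal.span {p | ∃ F ∈ S, p = ∏ i ∈ F, (MvPolynomial.X i : MvPolynomial (Fin n) K)}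

section

open CategoryTheory Opposite Limits

namespace Hm

theorem cat_aux {C : Type*} [Category C] {X X' H H' K K' : C} {u : X' ⟶ X} (α : X ≅ H) (α' : X' ≅ H')
    (h0 : H' ⟶ H) (γ : H ≅ K) (γ' : H' ≅ K') {k : K' ⟶ K}
    (e1 : u ≫ α.hom = α'.hom ≫ h0) (e2 : h0 ≫ γ.hom = γ'.hom ≫ k) :
    k ≫ γ.inv ≫ α.inv = (γ'.inv ≫ α'.inv) ≫ u := by
  have h1 : k = γ'.inv ≫ h0 ≫ γ.hom := by rw [e2]; simp
  have h2 : h0 = α'.inv ≫ u ≫ α.hom := by rw [e1]; simp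
  rw [h1, h2]; simp

section generic
variable {R : Type} [CommRing R]

/-- cocycle -/
def IsCyc (C : ChainComplex (ModuleCat.{0} R) ℕ) (i : ℕ) {M : ModuleCat.{0} R} (z : C.X i ⟶ M) : Prop :=
  ∀ j, C.d j i ≫ z = 0

/-- coboundary -/
def IsBd (C : ChainComplex (ModuleCat.{0} R) ℕ) (i : ℕ) {M : ModuleCat.{0} R} (z : C.X i ⟶ M) : Prop :=
  ∃ j, ∃ w : C.X j ⟶ M, z = C.d i j ≫ w

theorem sc_lift (S : ShortComplex (ModuleCat.{0} R)) (x : S.X₂) (hx : S.g x = 0) :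
    ∃ y : S.cycles, S.iCycles y = x := by
  refine ⟨S.moduleCatCyclesIso.inv ⟨x, hx⟩, ?_⟩
  have := S.moduleCatCyclesIso_inv_iCycles
  have := congrArg (fun f => f.hom (⟨x, hx⟩ : LinearMap.ker S.g.hom)) this
  exact this

theorem sc_surj (S : ShortComplex (ModuleCat.{0} R)) (c : S.homology) :
    ∃ y : S.cycles, S.homologyπ y = c :=
  (ModuleCat.epi_iff_surjective S.homologyπ).1 inferInstance c

theorem sc_zero (S : ShortComplex (ModuleCat.{0} R)) (y : S.cycles) :
    S.homologyπ y = 0 ↔ ∃ x : S.X₁, S.f x = S.iCycles y := by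
  constructor
  · intro h
    have h2 := congrArg (fun f => f.hom y) S.π_moduleCatCyclesIso_hom
    have h3 : S.moduleCatLeftHomologyData.π (S.moduleCatCyclesIso.hom y) = 0 := by
      rw [← show _ = S.moduleCatLeftHomologyData.π (S.moduleCatCyclesIso.hom y) from h2]
      change S.moduleCatHomologyIso.hom (S.homologyπ y) = 0
      rw [h]; simp
    obtain ⟨x, hx⟩ : ∃ x, S.moduleCatToCycles x = S.moduleCatCyclesIso.hom y :=
      (Submodule.Quotient.mk_eq_zero (LinearMap.range S.moduleCatToCycles)).1 h3
    refine ⟨x, ?_⟩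
    have h5 := congrArg (fun f => f.hom y) S.moduleCatCyclesIso_hom_i
    refine Eq.trans ?_ h5
    exact congrArg Subtype.val hx
  · rintro ⟨x, hx⟩
    have h1 : S.toCycles x = y := by
      apply (ModuleCat.mono_iff_injective S.iCycles).1 inferInstance
      rw [← hx]
      exact congrArg (fun f => f.hom x) S.toCycles_i
    rw [← h1]
    exact congrArg (fun f => f.hom x) S.toCycles_comp_homologyπ

end generic

section rep
variable {R : Type} [CommRing R] {X : ModuleCat.{0} R} (P : ProjectiveResolution X)

/-- `z` represents `e`. -/
def Rep (i : ℕ) (M : ModuleCat.{0} R) (z : P.complex.X i ⟶ M)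
    (e : ((Ext R (ModuleCat.{0} R) i).obj (op X)).obj M) : Prop :=
  ∃ y : (P.complex.linearYonedaObj R M).cycles i,
    (P.complex.linearYonedaObj R M).iCycles i y = z ∧
    (P.complex.linearYonedaObj R M).homologyπ i y = (P.isoExt i M).hom e

variable {P} {i : ℕ} {M : ModuleCat.{0} R}

theorem Rep.exists {z : P.complex.X i ⟶ M} (hz : IsCyc P.complex i z) : ∃ e, Rep P i M z e := by
  obtain ⟨y, hy⟩ := sc_lift ((P.complex.linearYonedaObj R M).sc i) z (by
    exact hz _)
  refine ⟨(P.isoExt i M).inv ((P.complex.linearYonedaObj R M).homologyπ i y), y, hy, ?_⟩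
  simp

theorem Rep.surj (P : ProjectiveResolution X) (i : ℕ) (M : ModuleCat.{0} R) (e) :
    ∃ z, IsCyc P.complex i z ∧ Rep P i M z e := by
  obtain ⟨y, hy⟩ := sc_surj ((P.complex.linearYonedaObj R M).sc i) ((P.isoExt i M).hom e)
  refine ⟨(P.complex.linearYonedaObj R M).iCycles i y, ?_, y, rfl, hy⟩
  intro j
  exact congrArg (fun f => f.hom y) ((P.complex.linearYonedaObj R M).iCycles_d i j)

theorem Rep.zero_iff {z : P.complex.X i ⟶ M} {e} (h : Rep P i M z e) :
    e = 0 ↔ IsBd P.complex i z := by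
  obtain ⟨y, hy, hy'⟩ := h
  have h1 : e = 0 ↔ (P.isoExt i M).hom e = 0 := by
    constructor
    · rintro rfl; simp
    · intro h
      have := congrArg (P.isoExt i M).inv h
      simpa using this
  rw [h1, ← hy']
  refine (sc_zero ((P.complex.linearYonedaObj R M).sc i) y).trans ?_
  constructor
  · rintro ⟨w, hw⟩
    refine ⟨_, w, ?_⟩
    rw [← hy]
    exact hw.symm
  · rintro ⟨j, w, hw⟩
    by_cases hj : j + 1 = i
    · obtain rfl : (ComplexShape.up ℕ).prev i = j := ComplexShape.prev_eq' _ hj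
      refine ⟨w, ?_⟩
      refine Eq.trans ?_ hy.symm
      exact hw.symm
    · refine ⟨0, ?_⟩
      refine Eq.trans ?_ hy.symm
      rw [hw, P.complex.shape i j (by simpa using hj)]
      rw [zero_comp, map_zero]; rfl

theorem Rep.smul {z : P.complex.X i ⟶ M} {e} (h : Rep P i M z e) (x : R) :
    Rep P i M (x • z) (x • e) := by
  obtain ⟨y, hy, hy'⟩ := h
  refine ⟨x • y, ?_, ?_⟩
  · rw [map_smul, hy]; rfl
  · rw [map_smul, hy', map_smul]


theorem Rep.nat {X' : ModuleCat.{0} R} {P' : ProjectiveResolution X'} (f : X' ⟶ X)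
    (φ : P'.complex ⟶ P.complex) (comm : φ.f 0 ≫ P.π.f 0 = P'.π.f 0 ≫ f)
    {z : P.complex.X i ⟶ M} {e} (h : Rep P i M z e) :
    Rep P' i M (φ.f i ≫ z) (((Ext R (ModuleCat.{0} R) i).map f.op).app M e) := by
  obtain ⟨y, hy, hy'⟩ := h
  let F := ((linearYoneda R (ModuleCat.{0} R)).obj M).rightOp
  let ψ0 := (F.mapHomologicalComplex (ComplexShape.down ℕ)).map φ
  let ψ : P.complex.linearYonedaObj R M ⟶ P'.complex.linearYonedaObj R M :=
    (HomologicalComplex.unopFunctor _ _).map ψ0.op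
  refine ⟨HomologicalComplex.cyclesMap ψ i y, ?_, ?_⟩
  · have := congrArg (fun f => f.hom y) (HomologicalComplex.cyclesMap_i ψ i)
    refine this.trans ?_
    change (ψ.f i).hom ((P.complex.linearYonedaObj R M).iCycles i y) = _
    rw [hy]
    rfl
  · have h1 := congrArg (fun f => f.hom y) (HomologicalComplex.homologyπ_naturality ψ i)
    refine h1.symm.trans ?_
    change (HomologicalComplex.homologyMap ψ i).hom ((P.complex.linearYonedaObj R M).homologyπ i y) = _
    rw [hy']
    have key : (P.isoExt i M).hom ≫ HomologicalComplex.homologyMap ψ i =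
      ((Ext R (ModuleCat.{0} R) i).map f.op).app M ≫ (P'.isoExt i M).hom := by
      have n1 := ProjectiveResolution.isoLeftDerivedObj_hom_naturality f P' P φ comm F i
      have n2 := HomologicalComplex.homologyOp_hom_naturality ψ i
      apply Quiver.Hom.op_inj
      exact cat_aux _ _ _ _ _ n1 n2
    exact congrArg (fun f => f.hom e) key

end rep
end Hm

end

section

open CategoryTheory Opposite Limits

namespace Hm
variable {R : Type} [CommRing R]

theorem IsBd.succ {C : ChainComplex (ModuleCat.{0} R) ℕ} {i : ℕ} {M : ModuleCat.{0} R}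
    {z : C.X (i+1) ⟶ M} (h : IsBd C (i+1) z) : ∃ w : C.X i ⟶ M, z = C.d (i+1) i ≫ w := by
  obtain ⟨j, w, rfl⟩ := h
  by_cases hj : j = i
  · subst hj; exact ⟨w, rfl⟩
  · exact ⟨0, by rw [C.shape _ _ (by simpa using hj)]; simp⟩

theorem IsBd.zero {C : ChainComplex (ModuleCat.{0} R) ℕ} {M : ModuleCat.{0} R}
    {z : C.X 0 ⟶ M} (h : IsBd C 0 z) : z = 0 := by
  obtain ⟨j, w, rfl⟩ := h
  rw [C.shape _ _ (by simp)]; simp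

theorem IsCyc.of {C : ChainComplex (ModuleCat.{0} R) ℕ} {i : ℕ} {M : ModuleCat.{0} R}
    {z : C.X i ⟶ M} (h : C.d (i+1) i ≫ z = 0) : IsCyc C i z := by
  intro j
  by_cases hj : j = i+1
  · subst hj; exact h
  · rw [C.shape _ _ (by simpa using fun h => hj h.symm)]; simp

theorem IsBd.smul {C : ChainComplex (ModuleCat.{0} R) ℕ} {i : ℕ} {M : ModuleCat.{0} R}
    {z : C.X i ⟶ M} (h : IsBd C i z) (x : R) : IsBd C i (x • z) := by
  obtain ⟨j, w, rfl⟩ := h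
  exact ⟨j, x • w, by simp⟩

theorem IsBd.comp {C : ChainComplex (ModuleCat.{0} R) ℕ} {i : ℕ} {M M' : ModuleCat.{0} R}
    {z : C.X i ⟶ M} (h : IsBd C i z) (f : M ⟶ M') : IsBd C i (z ≫ f) := by
  obtain ⟨j, w, rfl⟩ := h
  exact ⟨j, w ≫ f, by simp⟩

theorem IsBd.pre {C C' : ChainComplex (ModuleCat.{0} R) ℕ} {i : ℕ} {M : ModuleCat.{0} R}
    {z : C.X i ⟶ M} (h : IsBd C i z) (φ : C' ⟶ C) : IsBd C' i (φ.f i ≫ z) := by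
  obtain ⟨j, w, rfl⟩ := h
  exact ⟨j, φ.f j ≫ w, by simp⟩

theorem IsCyc.pre {C C' : ChainComplex (ModuleCat.{0} R) ℕ} {i : ℕ} {M : ModuleCat.{0} R}
    {z : C.X i ⟶ M} (h : IsCyc C i z) (φ : C' ⟶ C) : IsCyc C' i (φ.f i ≫ z) := by
  intro j
  rw [← Category.assoc, ← φ.comm, Category.assoc, h, comp_zero]

/-- vanishing of Ext -/
def V (N : ModuleCat.{0} R) (i : ℕ) (M : ModuleCat.{0} R) : Prop :=
  ∀ z : (projectiveResolution N).complex.X i ⟶ M, IsCyc _ i z → IsBd _ i z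

theorem V_iff (N M : ModuleCat.{0} R) (i : ℕ) :
    V N i M ↔ Subsingleton (((Ext R (ModuleCat.{0} R) i).obj (op N)).obj M) := by
  constructor
  · intro h
    refine ⟨fun a b => ?_⟩
    have : ∀ e : (((Ext R (ModuleCat.{0} R) i).obj (op N)).obj M), e = 0 := by
      intro e
      obtain ⟨z, hz, hr⟩ := Rep.surj (projectiveResolution N) i M e
      exact hr.zero_iff.2 (h z hz)
    rw [this a, this b]
  · intro h z hz
    obtain ⟨e, he⟩ := Rep.exists hz
    exact he.zero_iff.1 (Subsingleton.elim _ _)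

theorem smul_bd {N : ModuleCat.{0} R} (P : ProjectiveResolution N) {i : ℕ} {M : ModuleCat.{0} R} (x : R) (hx : ∀ u : N, x • u = 0)
    (z : P.complex.X i ⟶ M) (hz : IsCyc P.complex i z) : IsBd P.complex i (x • z) := by
  have hom : Homotopy (x • 𝟙 P.complex) 0 := by
    refine ProjectiveResolution.liftHomotopyZero (x • 𝟙 P.complex) ?_
    ext : 2
    ext u
    exact (map_smul (P.π.f 0).hom x u).trans (hx _)
  have h := hom.comm i
  have h' : x • z = (x • 𝟙 P.complex).f i ≫ z := by
    simp
  rw [h', h]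
  rcases i with _ | i
  · rw [Homotopy.dNext_zero_chainComplex, Homotopy.prevD_chainComplex]
    refine ⟨0, 0, ?_⟩
    have := hz 1
    simp [this]
  · rw [Homotopy.dNext_succ_chainComplex, Homotopy.prevD_chainComplex]
    refine ⟨i, hom.hom i (i+1) ≫ z, ?_⟩
    have := hz (i+2)
    simp [this]

section LES
variable {S : ShortComplex (ModuleCat.{0} R)} (hS : S.ShortExact) (N : ModuleCat.{0} R)
include hS

theorem V_three {i : ℕ} (h2 : V N i S.X₂) (h1 : V N (i+1) S.X₁) : V N i S.X₃ := by
  have := hS.epi_g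
  have := hS.mono_f
  intro z hz
  let z' := Projective.factorThru z S.g
  have hz' : z' ≫ S.g = z := Projective.factorThru_comp z S.g
  let c := hS.exact.liftFromProjective ((projectiveResolution N).complex.d (i+1) i ≫ z') (by
    rw [Category.assoc, hz', hz])
  have hc : c ≫ S.f = _ := hS.exact.liftFromProjective_comp _ _
  obtain ⟨w, hw⟩ := (h1 c (by
    intro j; rw [← cancel_mono S.f, Category.assoc, hc]; simp)).succ
  have := (h2 (z' - w ≫ S.f) (by
    apply IsCyc.of
    rw [Preadditive.comp_sub, ← Category.assoc, ← hw, hc, sub_self])).comp S.g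
  simpa [hz'] using this

theorem V_two {i : ℕ} (h1 : V N i S.X₁) (h3 : V N i S.X₃) : V N i S.X₂ := by
  have := hS.epi_g
  have := hS.mono_f
  intro z hz
  obtain ⟨j, u, hu⟩ := h3 (z ≫ S.g) (fun j => by rw [← Category.assoc, hz, zero_comp])
  let u' := Projective.factorThru u S.g
  have hu' : u' ≫ S.g = u := Projective.factorThru_comp u S.g
  let c := hS.exact.liftFromProjective (z - (projectiveResolution N).complex.d i j ≫ u') (by
    rw [Preadditive.sub_comp, Category.assoc, hu', hu, sub_self])
  have hc : c ≫ S.f = _ := hS.exact.liftFromProjective_comp _ _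
  have h := (h1 c (by
    intro j; rw [← cancel_mono S.f, Category.assoc, hc]; simp [hz _])).comp S.f
  rw [hc] at h
  by_cases hj : j + 1 = i
  · subst hj
    obtain ⟨w, hw⟩ := h.succ
    exact ⟨j, w + u', by rw [Preadditive.comp_add, ← hw]; simp⟩
  · rw [HomologicalComplex.shape _ _ _ (by simpa using hj)] at h
    simpa using h

theorem V_one {i : ℕ} (h3 : ∀ j, j + 1 = i → V N j S.X₃) (h2 : V N i S.X₂) : V N i S.X₁ := by
  have := hS.epi_g
  have := hS.mono_f
  intro z hz
  obtain h := h2 (z ≫ S.f) (fun j => by rw [← Category.assoc, hz, zero_comp])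
  rcases i with _ | i
  · refine ⟨0, 0, ?_⟩
    have := h.zero
    rw [← cancel_mono S.f, this]; simp
  · obtain ⟨w, hw⟩ := h.succ
    obtain ⟨j, u, hu⟩ := h3 i rfl (w ≫ S.g) (IsCyc.of (by rw [← Category.assoc, ← hw]; simp))
    let u' := Projective.factorThru u S.g
    have hu' : u' ≫ S.g = u := Projective.factorThru_comp u S.g
    let c := hS.exact.liftFromProjective (w - (projectiveResolution N).complex.d i j ≫ u') (by
      rw [Preadditive.sub_comp, Category.assoc, hu', hu, sub_self])
    have hc : c ≫ S.f = _ := hS.exact.liftFromProjective_comp _ _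
    refine ⟨i, c, ?_⟩
    rw [← cancel_mono S.f, Category.assoc, hc, hw]; simp

omit hS

end LES

/-- Rees step. -/
theorem V_rees (N : ModuleCat.{0} R) {i : ℕ} (x : R) (hx : ∀ u : N, x • u = 0) (M : ModuleCat.{0} R)
    (M'' : ModuleCat.{0} R) (g : M ⟶ M'') (wg : (x • 𝟙 M) ≫ g = 0)
    (hS : (ShortComplex.mk (x • 𝟙 M) g wg).ShortExact)
    (h3 : ∀ j, j + 1 = i → V N j M'') : V N i M := by
  have hg : Epi g := hS.epi_g
  have hf : Mono (x • 𝟙 M) := hS.mono_f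
  intro z hz
  have hsm : ∀ {A : ModuleCat.{0} R} (z : A ⟶ M), z ≫ (x • 𝟙 M) = x • z := by intro A z; simp
  have h := smul_bd (projectiveResolution N) x hx z hz
  rcases i with _ | i
  · refine ⟨0, 0, ?_⟩
    have := h.zero
    rw [← cancel_mono (x • 𝟙 M), hsm, this]; simp
  · obtain ⟨w, hw⟩ := h.succ
    obtain ⟨j, u, hu⟩ := h3 i rfl (w ≫ g) (IsCyc.of (by
      rw [← Category.assoc, ← hw, ← hsm, Category.assoc, wg, comp_zero]))
    let u' := Projective.factorThru u g
    have hu' : u' ≫ g = u := Projective.factorThru_comp u g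
    let c := hS.exact.liftFromProjective (w - (projectiveResolution N).complex.d i j ≫ u') (by
      change _ ≫ g = 0
      rw [Preadditive.sub_comp, Category.assoc, hu', hu, sub_self])
    have hc : c ≫ (x • 𝟙 M) = _ := hS.exact.liftFromProjective_comp _ _
    refine ⟨i, c, ?_⟩
    rw [← cancel_mono (x • 𝟙 M), Category.assoc, hc, hsm, hw]; simp

/-- augmentation -/
def aug {N : ModuleCat.{0} R} (P : ProjectiveResolution N) : P.complex.X 0 ⟶ N := P.π.f 0

theorem d_aug {N : ModuleCat.{0} R} (P : ProjectiveResolution N) : P.complex.d 1 0 ≫ aug P = 0 :=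
  P.complex_d_comp_π_f_zero

theorem aug_surj {N : ModuleCat.{0} R} (P : ProjectiveResolution N) : Function.Surjective (aug P) :=
  (ModuleCat.epi_iff_surjective _).1 (inferInstanceAs (Epi (P.π.f 0)))

theorem aug_desc {N M : ModuleCat.{0} R} (P : ProjectiveResolution N) (z : P.complex.X 0 ⟶ M)
    (hz : P.complex.d 1 0 ≫ z = 0) : ∃ g : N ⟶ M, aug P ≫ g = z :=
  ⟨P.exact₀.desc z hz, P.exact₀.g_desc _ _⟩

theorem lift_aug {N N' : ModuleCat.{0} R} (f : N ⟶ N') (P : ProjectiveResolution N)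
    (Q : ProjectiveResolution N') : (ProjectiveResolution.lift f P Q).f 0 ≫ aug Q = aug P ≫ f :=
  ProjectiveResolution.lift_commutes_zero _ _ _

/-- transition map -/
noncomputable def tr (J : Ideal R) {k l : ℕ} (h : k ≤ l) :
    ModuleCat.of R (R ⧸ J ^ l) ⟶ ModuleCat.of R (R ⧸ J ^ k) :=
  ModuleCat.ofHom <| Submodule.mapQ _ _ LinearMap.id (Ideal.pow_le_pow_right h)

theorem tr_comp (J : Ideal R) {k l m : ℕ} (h : k ≤ l) (h' : l ≤ m) :
    tr J h' ≫ tr J h = tr J (h.trans h') := by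
  ext : 1
  exact Submodule.linearMap_qext _ (LinearMap.ext fun x => rfl)

/-- resolution of `R ⧸ J ^ k` -/
noncomputable abbrev PR (J : Ideal R) (k : ℕ) := projectiveResolution (ModuleCat.of R (R ⧸ J ^ k))

/-- `x` kills the local cohomology (cocycle level). -/
def Kills (J : Ideal R) (x : R) (i : ℕ) (M : ModuleCat.{0} R) : Prop :=
  ∀ k (z : (PR J k).complex.X i ⟶ M), IsCyc _ i z →
    ∃ l, ∃ h : k ≤ l, ∃ φ : (PR J l).complex ⟶ (PR J k).complex,
      φ.f 0 ≫ aug (PR J k) = aug (PR J l) ≫ tr J h ∧ IsBd _ i (φ.f i ≫ (x • z))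

theorem Kills.ann (J : Ideal R) (x : R) (i : ℕ) (M : ModuleCat.{0} R) (h : ∀ u : M, x • u = 0) :
    Kills J x i M := by
  intro k z _
  refine ⟨k, le_rfl, ProjectiveResolution.lift (tr J le_rfl) _ _,
    lift_aug _ _ _, 0, 0, ?_⟩
  have : x • z = 0 := by
    ext u; exact h _
  rw [this]; simp

theorem Kills.mul {J : Ideal R} {x : R} {i : ℕ} {M : ModuleCat.{0} R} (h : Kills J x i M) (y : R) :
    Kills J (y * x) i M := by
  intro k z hz
  obtain ⟨l, hl, φ, hφ, hb⟩ := h k z hz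
  refine ⟨l, hl, φ, hφ, ?_⟩
  have := hb.smul y
  rwa [← Linear.comp_smul, smul_smul] at this

theorem Kills.three {J : Ideal R} {S : ShortComplex (ModuleCat.{0} R)} (hS : S.ShortExact) {i : ℕ} {a b : R}
    (h2 : Kills J b i S.X₂) (h1 : Kills J a (i+1) S.X₁) : Kills J (a * b) i S.X₃ := by
  have := hS.epi_g
  have := hS.mono_f
  intro k z hz
  let z' := Projective.factorThru z S.g
  have hz' : z' ≫ S.g = z := Projective.factorThru_comp z S.g
  let c := hS.exact.liftFromProjective ((PR J k).complex.d (i+1) i ≫ z') (by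
    rw [Category.assoc, hz', hz])
  have hc : c ≫ S.f = _ := hS.exact.liftFromProjective_comp _ _
  obtain ⟨l, hl, φ, hφ, hb⟩ := h1 k c (by
    intro j; rw [← cancel_mono S.f, Category.assoc, hc]; simp)
  obtain ⟨w, hw⟩ := hb.succ
  obtain ⟨l', hl', φ', hφ', hb'⟩ := h2 l (a • (φ.f i ≫ z') - w ≫ S.f) (by
    apply IsCyc.of
    rw [Preadditive.comp_sub, ← Category.assoc _ w, ← hw, Category.assoc, Linear.smul_comp, hc,
      Linear.comp_smul, Linear.comp_smul, φ.comm_assoc, sub_self])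
  refine ⟨l', hl.trans hl', φ' ≫ φ, ?_, ?_⟩
  · rw [HomologicalComplex.comp_f, Category.assoc, hφ, ← tr_comp J hl hl', ← Category.assoc, hφ',
      Category.assoc]
  · have := hb'.comp S.g
    have e : (φ'.f i ≫ (b • (a • (φ.f i ≫ z') - w ≫ S.f))) ≫ S.g = (φ' ≫ φ).f i ≫ ((a * b) • z) := by
      simp [hz', smul_smul, mul_comm]
    rwa [e] at this

theorem Kills.zero {J : Ideal R} {x : R} {M : ModuleCat.{0} R} (h : Kills J x 0 M) {k : ℕ} {u : M}
    (hu : ∀ y ∈ J ^ k, y • u = 0) : x • u = 0 := by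
  let g : ModuleCat.of R (R ⧸ J ^ k) ⟶ M := ModuleCat.ofHom
    (Submodule.liftQ _ (LinearMap.toSpanSingleton R M u) (fun y hy => hu y hy))
  obtain ⟨l, hl, φ, hφ, hb⟩ := h k (aug (PR J k) ≫ g) (IsCyc.of (by
    rw [← Category.assoc]
    have := d_aug (PR J k)
    rw [this]; exact zero_comp))
  have h0 := hb.zero
  have h1 : aug (PR J l) ≫ (tr J hl ≫ (x • g)) = 0 := by
    rw [← Category.assoc, ← hφ, Category.assoc, Linear.comp_smul, h0]
  obtain ⟨p, hp⟩ := aug_surj (PR J l) (Submodule.Quotient.mk (1:R) : R ⧸ J ^ l)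
  have h3 := congrArg (fun f => f.hom p) h1
  have h4 : (tr J hl ≫ (x • g)).hom (aug (PR J l) p) = 0 := h3
  rw [hp] at h4
  have h6 : (tr J hl ≫ (x • g)).hom (Submodule.Quotient.mk (1:R) : R ⧸ J ^ l) = x • ((1:R) • u) := rfl
  rw [h6, one_smul] at h4
  exact h4

theorem Kills.one_zero {J : Ideal R} {M : ModuleCat.{0} R} (h : ∀ k, ∀ u : M, (∀ y ∈ J ^ k, y • u = 0) → u = 0) :
    Kills J 1 0 M := by
  intro k z hz
  refine ⟨k, le_rfl, ProjectiveResolution.lift (tr J le_rfl) _ _,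
    lift_aug _ _ _, 0, 0, ?_⟩
  have hz0 : z = 0 := by
    obtain ⟨g, hg⟩ := aug_desc _ z (hz 1)
    have : g = 0 := by
      ext : 1
      refine LinearMap.ext fun x => ?_
      obtain ⟨x, rfl⟩ := Submodule.Quotient.mk_surjective _ x
      have : g.hom (Submodule.Quotient.mk (1:R) : R ⧸ J ^ k) = 0 := by
        apply h k
        intro y hy
        rw [← map_smul]
        have : y • (Submodule.Quotient.mk (1:R) : R ⧸ J ^ k) = 0 := by
          rw [← Submodule.Quotient.mk_smul, Submodule.Quotient.mk_eq_zero]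
          simpa using hy
        exact (congrArg _ this).trans (map_zero _)
      have h2 : x • g.hom (Submodule.Quotient.mk (1:R) : R ⧸ J ^ k) = 0 := by rw [this, smul_zero]
      rw [← map_smul] at h2
      have e : x • (Submodule.Quotient.mk (1:R) : R ⧸ J ^ k) = Submodule.Quotient.mk x := by
        rw [← Submodule.Quotient.mk_smul]; simp
      exact (congrArg g.hom e.symm).trans h2
    rw [← hg, this]; exact comp_zero
  rw [hz0]; simp

end Hm

end

section

open CategoryTheory Opposite Limits

namespace Hm
variable {R : Type} [CommRing R]

/-- the colimit cocone of local cohomology evaluated at `M`. -/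
noncomputable def lcIsColimit (J : Ideal R) (i : ℕ) (M : ModuleCat.{0} R) :=
  isColimitOfPreserves ((evaluation (ModuleCat.{0} R) (ModuleCat.{0} R)).obj M)
    (colimit.isColimit (localCohomology.diagram (localCohomology.idealPowersDiagram J) i))

/-- the structure map -/
noncomputable def lcι (J : Ideal R) (i k : ℕ) (M : ModuleCat.{0} R) :
    ((Ext R (ModuleCat.{0} R) i).obj (op (ModuleCat.of R (R ⧸ J ^ k)))).obj M ⟶
      (localCohomology J i).obj M :=
  (colimit.ι (localCohomology.diagram (localCohomology.idealPowersDiagram J) i) (op (op k))).app M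

theorem lc_rep (J : Ideal R) (i : ℕ) (M : ModuleCat.{0} R) (y : (localCohomology J i).obj M) :
    ∃ k e, lcι J i k M e = y := by
  obtain ⟨k, e, h⟩ := Concrete.isColimit_exists_rep _ (lcIsColimit J i M) y
  exact ⟨k.unop.unop, e, h⟩

theorem lc_zero (J : Ideal R) (i : ℕ) (M : ModuleCat.{0} R) (k : ℕ)
    (e : ((Ext R (ModuleCat.{0} R) i).obj (op (ModuleCat.of R (R ⧸ J ^ k)))).obj M)
    (h : lcι J i k M e = 0) : ∃ l, ∃ hl : k ≤ l,
      ((Ext R (ModuleCat.{0} R) i).map (tr J hl).op).app M e = 0 := by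
  obtain ⟨l, f, g, h⟩ := Concrete.isColimit_exists_of_rep_eq _ (lcIsColimit J i M)
    (i := op (op k)) (j := op (op k)) e (0 : ((Ext R (ModuleCat.{0} R) i).obj (op (ModuleCat.of R (R ⧸ J ^ k)))).obj M) (by
      refine Eq.trans (b := 0) h ?_
      exact (map_zero (lcι J i k M).hom).symm)
  refine ⟨l.unop.unop, f.unop.unop.down.down, ?_⟩
  refine Eq.trans h ?_
  exact map_zero (((localCohomology.diagram (localCohomology.idealPowersDiagram J) i).map g).app M).hom

theorem kills_of_lc (J : Ideal R) (i : ℕ) (M : ModuleCat.{0} R) (x : R)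
    (h : ∀ y : (localCohomology J i).obj M, x • y = 0) : Kills J x i M := by
  intro k z hz
  obtain ⟨e, he⟩ := Rep.exists hz
  obtain ⟨l, hl, h0⟩ := lc_zero J i M k (x • e) (by rw [map_smul]; exact h _)
  refine ⟨l, hl, ProjectiveResolution.lift (tr J hl) _ _, lift_aug _ _ _, ?_⟩
  have := (he.smul x).nat (tr J hl) (ProjectiveResolution.lift (tr J hl) (PR J l) (PR J k)) (lift_aug _ _ _)
  exact this.zero_iff.1 h0

theorem lc_smul_of_surj (J : Ideal R) (i : ℕ) (M : ModuleCat.{0} R) (x : R) (hx : x ∈ J)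
    (h : Function.Surjective (lcι J i 1 M)) (y : (localCohomology J i).obj M) : x • y = 0 := by
  obtain ⟨e, rfl⟩ := h y
  rw [← map_smul]
  obtain ⟨z, hz, hr⟩ := Rep.surj (PR J 1) i M e
  have : x • e = 0 := by
    refine (hr.smul x).zero_iff.2 (smul_bd _ x ?_ z hz)
    intro u
    obtain ⟨u, rfl⟩ := Submodule.Quotient.mk_surjective _ u
    rw [← Submodule.Quotient.mk_smul, Submodule.Quotient.mk_eq_zero]
    simpa using Ideal.mul_mem_right _ _ hx
  rw [this, map_zero]

theorem lc_zero_of_V (J : Ideal R) (i : ℕ) (M : ModuleCat.{0} R)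
    (h : ∀ k, V (ModuleCat.of R (R ⧸ J ^ k)) i M) (y : (localCohomology J i).obj M) : y = 0 := by
  obtain ⟨k, e, rfl⟩ := lc_rep J i M y
  have := (V_iff _ _ _).1 (h k)
  rw [Subsingleton.elim e 0, map_zero]

end Hm

theorem IsQuasiBuchsbaum.kills {K : Type} [Field K] {n : ℕ} {I : Ideal (MvPolynomial (Fin n) K)}
    (h : IsQuasiBuchsbaum K I) {i : ℕ} (hi : (i : WithBot ℕ∞) < ringKrullDim (MvPolynomial (Fin n) K ⧸ I))
    (v : Fin n) : Hm.Kills (maxIdeal K n) (MvPolynomial.X v) i (ModuleCat.of _ (MvPolynomial (Fin n) K ⧸ I)) :=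
  Hm.kills_of_lc _ _ _ _ (h i hi _ (Ideal.subset_span ⟨v, rfl⟩))

theorem IsBuchsbaum.quasi {K : Type} [Field K] {n : ℕ} {I : Ideal (MvPolynomial (Fin n) K)}
    (h : IsBuchsbaum K I) : IsQuasiBuchsbaum K I := by
  intro i hi x hx y
  exact Hm.lc_smul_of_surj (maxIdeal K n) i _ x hx (h i hi) y

theorem isBuchsbaum_of_V {K : Type} [Field K] {n : ℕ} {I : Ideal (MvPolynomial (Fin n) K)}
    (h : ∀ i : ℕ, (i : WithBot ℕ∞) < ringKrullDim (MvPolynomial (Fin n) K ⧸ I) → ∀ k,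
      Hm.V (ModuleCat.of (MvPolynomial (Fin n) K) (MvPolynomial (Fin n) K ⧸ maxIdeal K n ^ k)) i (ModuleCat.of (MvPolynomial (Fin n) K) (MvPolynomial (Fin n) K ⧸ I))) :
    IsBuchsbaum K I := by
  intro i hi y
  exact ⟨0, (map_zero _).trans (Hm.lc_zero_of_V (maxIdeal K n) i _ (h i hi) y).symm⟩

end

section

open Finset

namespace Cb
variable {n : ℕ} (Δ : SimComplex n) (m : ℕ)

/-- multiplicity -/
def cnt {m : ℕ} (F : Fin m → Finset (Fin n)) (i : Fin n) : ℕ := (univ.filter (fun j => i ∈ F j)).card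

/-- exponent in localized power -/
def Pow (G : Finset (Fin n)) (a : Fin n → ℕ) : Prop :=
  ∃ F : Fin m → Finset (Fin n), (∀ j, F j ∉ Δ.faces) ∧ ∀ i ∉ G, cnt F i ≤ a i

/-- weight off `F` -/
def wt (F : Finset (Fin n)) (a : Fin n → ℕ) : ℕ := ∑ i ∈ Fᶜ, a i

/-- symbolic condition -/
def JE (E : Finset (Fin n) → Prop) (a : Fin n → ℕ) : Prop := ∀ F, E F → m ≤ wt F a

def H0 (G : Finset (Fin n)) : Prop := ∀ a : Fin n → ℕ,
  (∀ v ∉ G, ∃ k, Pow Δ m G (a + Pi.single v k)) → Pow Δ m G a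

def H1 (G : Finset (Fin n)) : Prop := (∃ F, Δ.IsFacet F ∧ G ⊆ F ∧ G.card + 2 ≤ F.card) →
  ∀ E1 E2 : Finset (Fin n) → Prop, (∀ F, (Δ.IsFacet F ∧ G ⊆ F) ↔ (E1 F ∨ E2 F)) →
  ∀ a : Fin n → ℕ, (∀ v ∉ G, ∃ k, JE m E1 (a + Pi.single v k) ∨ JE m E2 (a + Pi.single v k)) →
    JE m E1 a ∨ JE m E2 a

def H1' : Prop :=
  ∀ E1 E2 : Finset (Fin n) → Prop, (∀ F, Δ.IsFacet F ↔ (E1 F ∨ E2 F)) →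
  (∀ v, ∃ k, JE m E1 (Pi.single v k) ∨ JE m E2 (Pi.single v k)) →
    ∀ v, JE m E1 (Pi.single v 2) ∨ JE m E2 (Pi.single v 2)

variable {Δ m}

theorem cnt_le {m : ℕ} (F : Fin m → Finset (Fin n)) (i : Fin n) : cnt F i ≤ m := by
  unfold cnt
  exact (card_filter_le _ _).trans (by simp)

theorem wt_add (F : Finset (Fin n)) (a b : Fin n → ℕ) : wt F (a + b) = wt F a + wt F b := by
  simp [wt, sum_add_distrib]

theorem wt_single (F : Finset (Fin n)) (v : Fin n) (k : ℕ) :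
    wt F (Pi.single v k) = if v ∈ F then 0 else k := by
  unfold wt
  rw [Finset.sum_pi_single']; simp

theorem exists_facet {X : Finset (Fin n)} (hX : X ∈ Δ.faces) : ∃ F, Δ.IsFacet F ∧ X ⊆ F := by
  classical
  obtain ⟨F, hF, hmax⟩ := exists_max_image (univ.filter (fun F => F ∈ Δ.faces ∧ X ⊆ F)) card
    ⟨X, by simp [hX]⟩
  simp only [mem_filter, mem_univ, true_and] at hF hmax
  refine ⟨F, ⟨hF.1, fun G hG hFG => ?_⟩, hF.2⟩
  exact eq_of_subset_of_card_le hFG (hmax G ⟨hG, hF.2.trans hFG⟩)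

theorem exists_choice (s : Finset (Fin n)) : ∀ (m : ℕ) (a : Fin n → ℕ), m ≤ ∑ i ∈ s, a i →
    ∃ v : Fin m → Fin n, (∀ j, v j ∈ s) ∧ ∀ i, (univ.filter (fun j => v j = i)).card ≤ a i := by
  intro m
  induction m with
  | zero => intro a _; exact ⟨Fin.elim0, fun j => j.elim0, by simp⟩
  | succ m ih =>
    intro a ha
    obtain ⟨i0, hi0, hpos⟩ : ∃ i ∈ s, 0 < a i := by
      by_contra! h
      have : ∑ i ∈ s, a i = 0 := sum_eq_zero (fun i hi => by have := h i hi; omega)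
      omega
    obtain ⟨v, hv, hc⟩ := ih (Function.update a i0 (a i0 - 1)) (by
      have h1 := sum_update_of_mem hi0 a (a i0 - 1)
      have h2 := add_sum_erase s a hi0
      rw [h1, sdiff_singleton_eq_erase]; omega)
    refine ⟨Fin.cons i0 v, fun j => ?_, fun i => ?_⟩
    · refine Fin.cases hi0 (fun j => ?_) j
      simpa using hv j
    · have h1 := hc i
      rw [card_filter] at h1 ⊢
      rw [Fin.sum_univ_succ]
      simp only [Fin.cons_zero, Fin.cons_succ]
      by_cases h : i0 = i
      · subst h
        simp at h1 ⊢; omega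
      · rw [Function.update_of_ne (Ne.symm h)] at h1
        simpa [h] using h1

theorem pow_facet {G : Finset (Fin n)} (hG : Δ.IsFacet G) {a : Fin n → ℕ} (h : m ≤ wt G a) :
    Pow Δ m G a := by
  obtain ⟨v, hv, hc⟩ := exists_choice Gᶜ m a h
  refine ⟨fun j => insert (v j) G, fun j hj => ?_, fun i hi => ?_⟩
  · have := hG.2 _ hj (subset_insert _ _)
    have h2 := hv j
    rw [mem_compl] at h2
    exact h2 (this ▸ mem_insert_self _ _)
  · refine le_trans (card_le_card ?_) (hc i)
    intro j
    simp [hi, eq_comm]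

theorem pow_lift {G : Finset (Fin n)} {v : Fin n} {a : Fin n → ℕ}
    (h : Pow Δ m (insert v G) a) : Pow Δ m G (a + Pi.single v m) := by
  obtain ⟨F, hF, hc⟩ := h
  refine ⟨F, hF, fun i hi => ?_⟩
  by_cases hv : i = v
  · subst hv; have := cnt_le F i; simp; omega
  · have := hc i (by simp [hv, hi]); simp [hv, this]

theorem pow_nonface {G : Finset (Fin n)} {v : Fin n} {a : Fin n → ℕ}
    (h : insert v G ∉ Δ.faces) : Pow Δ m G (a + Pi.single v m) := by
  refine pow_lift ⟨fun _ => insert v G, fun _ => h, fun i hi => ?_⟩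
  simp [cnt, hi]

/-- D3 -/
theorem D3 (P : Finset (Fin n) → Prop) (hP : ∀ G v, P G → P (insert v G))
    (h0 : ∀ G ∈ Δ.faces, P G → ¬ Δ.IsFacet G → H0 Δ m G) :
    ∀ (k : ℕ) (G : Finset (Fin n)), Gᶜ.card ≤ k → G ∈ Δ.faces → P G → ∀ a : Fin n → ℕ,
      (∀ F, Δ.IsFacet F → G ⊆ F → m ≤ wt F a) → Pow Δ m G a := by
  intro k
  induction k with
  | zero =>
    intro G hk hG hne a ha
    refine pow_facet ⟨hG, fun G' _ h => ?_⟩ (ha G ⟨hG, fun G' _ h => ?_⟩ subset_rfl) <;>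
    · have : G = univ := by
        rw [← compl_eq_empty_iff, ← card_eq_zero]; omega
      subst this; exact (univ_subset_iff.1 h).symm
  | succ k ih =>
    intro G hk hG hne a ha
    by_cases hf : Δ.IsFacet G
    · exact pow_facet hf (ha G hf subset_rfl)
    · refine h0 G hG hne hf a fun v hv => ⟨m, ?_⟩
      by_cases hvf : insert v G ∈ Δ.faces
      · refine pow_lift (ih (insert v G) ?_ hvf (hP _ _ hne) a fun F hF hGF => ?_)
        · have : (insert v G)ᶜ.card < Gᶜ.card := by
            apply card_lt_card
            rw [compl_ssubset_compl]
            exact ssubset_insert hv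
          omega
        · exact ha F hF ((subset_insert _ _).trans hGF)
      · exact pow_nonface hvf

theorem pow_wt {G F : Finset (Fin n)} (hF : F ∈ Δ.faces) (hGF : G ⊆ F) {a : Fin n → ℕ} (h : Pow Δ m G a) :
    m ≤ wt F a := by
  obtain ⟨A, hA, hc⟩ := h
  have h1 : ∑ i ∈ Fᶜ, cnt A i ≤ wt F a := sum_le_sum fun i hi => hc i (by
    rw [mem_compl] at hi; exact fun h => hi (hGF h))
  refine le_trans ?_ h1
  have h2 : ∑ i ∈ Fᶜ, cnt A i = ∑ j, (Fᶜ.filter (fun i => i ∈ A j)).card := by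
    unfold cnt
    simp_rw [card_filter]
    rw [sum_comm]
  rw [h2]
  calc m = ∑ j : Fin m, 1 := by simp
    _ ≤ _ := sum_le_sum fun j _ => by
      rw [Nat.succ_le_iff, card_pos]
      by_contra h
      apply hA j
      refine Δ.down_closed hF fun i hi => ?_
      by_contra hi'
      exact h ⟨i, by simp [hi, hi']⟩

end Cb

end

section

open Finset

namespace Cb
variable {n : ℕ}

/-- the package of hypotheses -/
structure Hyp (Δ : SimComplex n) (m d : ℕ) : Prop where
  hm : 3 ≤ m
  hd : 3 ≤ d
  hmax : ∀ F ∈ Δ.faces, F.card ≤ d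
  hex : ∃ F ∈ Δ.faces, F.card = d
  h0 : ∀ G ∈ Δ.faces, G.Nonempty → ¬ Δ.IsFacet G → H0 Δ m G
  h1 : ∀ G ∈ Δ.faces, G.Nonempty → H1 Δ m G
  h1' : H1' Δ m

namespace Hyp
variable {Δ : SimComplex n} {m d : ℕ} (H : Hyp Δ m d)
include H

theorem conn {G : Finset (Fin n)} (hG : G ∈ Δ.faces)
    (hbig : ∃ F, Δ.IsFacet F ∧ G ⊆ F ∧ G.card + 2 ≤ F.card)
    (E1 E2 : Finset (Fin n) → Prop) (hE : ∀ F, (Δ.IsFacet F ∧ G ⊆ F) ↔ (E1 F ∨ E2 F))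
    (hdis : ∀ F1 F2, E1 F1 → E2 F2 → F1 ∩ F2 ⊆ G) (hn1 : ∃ F, E1 F) (hn2 : ∃ F, E2 F) : False := by
  have hm := H.hm
  have key : ∀ v ∉ G, JE m E1 (Pi.single v m) ∨ JE m E2 (Pi.single v m) := by
    intro v hv
    by_contra! h
    obtain ⟨h1, h2⟩ := h
    simp only [JE, not_forall] at h1 h2
    obtain ⟨F1, hF1, h1⟩ := h1
    obtain ⟨F2, hF2, h2⟩ := h2
    rw [wt_single] at h1 h2
    split_ifs at h1 h2 with h3 h4
    · exact hv (hdis F1 F2 hF1 hF2 (mem_inter.2 ⟨h3, h4⟩))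
    all_goals omega
  obtain ⟨F1, hF1⟩ := hn1
  obtain ⟨F2, hF2⟩ := hn2
  rcases G.eq_empty_or_nonempty with rfl | hne
  · obtain ⟨F, hF, _, hc⟩ := hbig
    obtain ⟨v, hv⟩ : F.Nonempty := card_pos.1 (by simp at hc; omega)
    have h2 := H.h1' E1 E2 (fun F => by rw [← hE]; simp)
      (fun v => ⟨m, key v (by simp)⟩) v
    rcases h2 with h2 | h2
    · have := h2 F1 hF1; rw [wt_single] at this; split_ifs at this <;> omega
    · have := h2 F2 hF2; rw [wt_single] at this; split_ifs at this <;> omega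
  · have h2 := H.h1 G hG hne hbig E1 E2 hE 0 (fun v hv => ⟨m, by simpa using key v hv⟩)
    rcases h2 with h2 | h2
    · have := h2 F1 hF1; simp [wt] at this; omega
    · have := h2 F2 hF2; simp [wt] at this; omega

theorem facet_of_card {F : Finset (Fin n)} (hF : F ∈ Δ.faces) (hc : F.card = d) : Δ.IsFacet F :=
  ⟨hF, fun G hG hFG => eq_of_subset_of_card_le hFG (by rw [hc]; exact H.hmax G hG)⟩

theorem pure {F F' : Finset (Fin n)} (hF : Δ.IsFacet F) (hF' : Δ.IsFacet F') : F.card = F'.card := by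
  classical
  by_contra hne
  obtain ⟨⟨A, B⟩, hAB, hmax⟩ := exists_max_image
    (univ.filter (fun p : Finset (Fin n) × Finset (Fin n) =>
      Δ.IsFacet p.1 ∧ Δ.IsFacet p.2 ∧ p.1.card ≠ p.2.card)) (fun p => (p.1 ∩ p.2).card)
    ⟨(F, F'), by simp [hF, hF', hne]⟩
  simp only [mem_filter, mem_univ, true_and] at hAB hmax
  obtain ⟨hA, hB, hc⟩ := hAB
  have hA1 : (A ∩ B).card < A.card := by
    apply card_lt_card
    refine (inter_subset_left).ssubset_of_ne fun h => hc ?_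
    rw [hA.2 B hB.1 (inter_eq_left.1 h)]
  have hB1 : (A ∩ B).card < B.card := by
    apply card_lt_card
    refine (inter_subset_right).ssubset_of_ne fun h => hc ?_
    rw [← hB.2 A hA.1 (inter_eq_right.1 h)]
  refine H.conn (G := A ∩ B) (Δ.down_closed hA.1 inter_subset_left) ?_
    (fun X => Δ.IsFacet X ∧ A ∩ B ⊆ X ∧ X.card = A.card)
    (fun X => Δ.IsFacet X ∧ A ∩ B ⊆ X ∧ X.card ≠ A.card) (fun X => by tauto) ?_
    ⟨A, hA, inter_subset_left, rfl⟩ ⟨B, hB, inter_subset_right, fun h => hc h.symm⟩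
  · rcases lt_or_gt_of_ne hc with h | h
    · exact ⟨B, hB, inter_subset_right, by omega⟩
    · exact ⟨A, hA, inter_subset_left, by omega⟩
  · rintro X Y ⟨hX, hX1, hX2⟩ ⟨hY, hY1, hY2⟩
    have := hmax (X, Y) ⟨hX, hY, by rw [hX2]; exact fun h => hY2 h.symm⟩
    exact (eq_of_subset_of_card_le (subset_inter hX1 hY1) this).ge

theorem facet_card {F : Finset (Fin n)} (hF : Δ.IsFacet F) : F.card = d := by
  obtain ⟨A, hA, hc⟩ := H.hex
  rw [← hc]; exact H.pure hF (H.facet_of_card hA hc)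

theorem D2 {G : Finset (Fin n)} (hc : G.card + 1 = d) {x y z : Fin n} (hx : x ∉ G) (hy : y ∉ G)
    (hz : z ∉ G) (hxy : x ≠ y) (hxz : x ≠ z) (hyz : y ≠ z) (fx : insert x G ∈ Δ.faces)
    (fy : insert y G ∈ Δ.faces) (fz : insert z G ∈ Δ.faces) : False := by
  have hm := H.hm
  have hd := H.hd
  have hG : G ∈ Δ.faces := Δ.down_closed fx (subset_insert _ _)
  have two : ∀ F, Δ.IsFacet F → G ⊆ F → ∀ p q, p ∉ G → q ∉ G → p ≠ q → p ∈ F → q ∈ F → False := by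
    intro F hF hGF p q hp hq hpq hpF hqF
    have h1 : (insert p (insert q G)).card ≤ F.card :=
      card_le_card (by intro t; simp; rintro (rfl | rfl | h) <;> [assumption; assumption; exact hGF h])
    rw [card_insert_of_notMem (by simp [hpq, hp]), card_insert_of_notMem hq, H.facet_card hF] at h1
    omega
  set a : Fin n → ℕ := Pi.single x (m-1) + Pi.single y (m-1) + Pi.single z 1 with ha
  have hP : Pow Δ m G a := by
    refine D3 (fun G => G.Nonempty) (fun G v _ => ⟨v, mem_insert_self _ _⟩) H.h0 _ G le_rfl hG
      (card_pos.1 (by omega)) a ?_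
    intro F hF hGF
    have h1 := two F hF hGF x y hx hy hxy
    have h2 := two F hF hGF x z hx hz hxz
    have h3 := two F hF hGF y z hy hz hyz
    rw [ha, wt_add, wt_add, wt_single, wt_single, wt_single]
    split_ifs <;> first | omega | tauto
  obtain ⟨A, hA, hcA⟩ := hP
  have h1 : ∑ i ∈ Gᶜ, cnt A i ≤ wt G a := sum_le_sum fun i hi => hcA i (by simpa using hi)
  have h2 : ∑ i ∈ Gᶜ, cnt A i = ∑ j, (Gᶜ.filter (fun i => i ∈ A j)).card := by
    unfold cnt
    simp_rw [card_filter]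
    rw [sum_comm]
  rw [ha, wt_add, wt_add, wt_single, wt_single, wt_single, h2] at h1
  simp only [hx, hy, hz, if_false] at h1
  have h3 : 2 * m ≤ ∑ j, (Gᶜ.filter (fun i => i ∈ A j)).card := by
    calc 2 * m = ∑ j : Fin m, 2 := by simp [mul_comm]
    _ ≤ _ := sum_le_sum fun j _ => by
      by_contra h
      have h4 : (Gᶜ.filter (fun i => i ∈ A j)).card ≤ 1 := by omega
      have h5 : ∃ t, insert t G ∈ Δ.faces ∧ Gᶜ.filter (fun i => i ∈ A j) ⊆ {t} := by
        rcases (Gᶜ.filter (fun i => i ∈ A j)).eq_empty_or_nonempty with h6 | ⟨t, ht⟩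
        · exact ⟨x, fx, by simp [h6]⟩
        · refine ⟨t, ?_, fun s hs => by
            rw [mem_singleton]; exact card_le_one.1 h4 s hs t ht⟩
          rw [mem_filter, mem_compl] at ht
          have h7 : 1 ≤ cnt A t := card_pos.2 ⟨j, by simp [ht.2]⟩
          have h8 := hcA t ht.1
          by_cases htx : t = x
          · rwa [htx]
          by_cases hty : t = y
          · rwa [hty]
          by_cases htz : t = z
          · rwa [htz]
          simp [ha, htx, hty, htz] at h8
          omega
      obtain ⟨t, ht, hs⟩ := h5
      refine hA j (Δ.down_closed ht fun s hs' => ?_)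
      by_cases hsG : s ∈ G
      · exact mem_insert_of_mem hsG
      · have := hs (mem_filter.2 ⟨mem_compl.2 hsG, hs'⟩)
        rw [mem_singleton] at this
        rw [this]; exact mem_insert_self _ _
  omega

theorem path {G : Finset (Fin n)} (hc : G.card + 2 = d) {p q r s : Fin n} (hp : p ∉ G) (hq : q ∉ G)
    (hr : r ∉ G) (hs : s ∉ G) (hpq : p ≠ q) (hpr : p ≠ r) (hps : p ≠ s) (hqr : q ≠ r)
    (hqs : q ≠ s) (hrs : r ≠ s) (f1 : insert p (insert q G) ∈ Δ.faces)
    (f2 : insert q (insert r G) ∈ Δ.faces) (f3 : insert r (insert s G) ∈ Δ.faces) :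
    insert p (insert s G) ∈ Δ.faces := by
  have hm := H.hm
  have hd := H.hd
  by_contra hcon
  have hG : G ∈ Δ.faces := Δ.down_closed f1 (by intro z; simp; tauto)
  have card2 : ∀ x y, x ∉ G → y ∉ G → x ≠ y → (insert x (insert y G)).card = d := by
    intro x y hx hy hxy
    rw [card_insert_of_notMem (by simp [hxy, hx]), card_insert_of_notMem hy]; omega
  have fac1 := H.facet_of_card f1 (card2 p q hp hq hpq)
  have fac3 := H.facet_of_card f3 (card2 r s hr hs hrs)
  have hne : insert r (insert s G) ≠ insert p (insert q G) := by
    intro h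
    have : r ∈ insert p (insert q G) := h ▸ mem_insert_self _ _
    simp [hpr.symm, hqr.symm, hr] at this
  have hnq : insert q (insert s G) ∉ Δ.faces := by
    intro h
    refine H.D2 (G := insert q G) (by rw [card_insert_of_notMem hq]; omega) (x := p) (y := r) (z := s)
      (by simp [hp, hpq]) (by simp [hr, hqr.symm]) (by simp [hs, hqs.symm]) hpr hps hrs f1 ?_ ?_
    · rwa [insert_comm]
    · rwa [insert_comm]
  have hfac : ∀ F, Δ.IsFacet F → G ⊆ F → ∀ x y, x ∈ F → y ∈ F → insert x (insert y G) ∈ Δ.faces := by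
    intro F hF hGF x y hx hy
    refine Δ.down_closed hF.1 ?_
    intro t; simp; rintro (rfl | rfl | h) <;> [assumption; assumption; exact hGF h]
  have h1 := H.h1 G hG (card_pos.1 (by omega)) ⟨_, fac1, by intro z; simp; tauto, by rw [card2 p q hp hq hpq]; omega⟩
    (fun F => F = insert p (insert q G)) (fun F => (Δ.IsFacet F ∧ G ⊆ F) ∧ F ≠ insert p (insert q G))
    (fun F => by
      constructor
      · intro h; by_cases h' : F = insert p (insert q G)
        · exact Or.inl h'
        · exact Or.inr ⟨h, h'⟩
      · rintro (rfl | h)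
        · exact ⟨fac1, by intro z; simp; tauto⟩
        · exact h.1)
    (Pi.single p (m-2) + Pi.single q 1 + Pi.single s (m-1)) ?_
  · rcases h1 with h1 | h1
    · have := h1 _ rfl
      rw [wt_add, wt_add, wt_single, wt_single, wt_single] at this
      simp [hps.symm, hqs.symm, hs] at this
      omega
    · have := h1 _ ⟨⟨fac3, by intro z; simp; tauto⟩, hne⟩
      rw [wt_add, wt_add, wt_single, wt_single, wt_single] at this
      simp [hps, hqs, hp, hq, hpr, hqr] at this
      omega
  · intro v hv
    refine ⟨m, ?_⟩
    by_cases hvp : v = p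
    · subst hvp
      right
      rintro F ⟨⟨hF, hGF⟩, hFne⟩
      rw [wt_add, wt_add, wt_add, wt_single, wt_single, wt_single, wt_single]
      by_cases hvF : v ∈ F
      · have hqF : q ∉ F := fun h => hFne (fac1.2 F hF.1 (by
          intro t; simp; rintro (rfl | rfl | h) <;> [assumption; assumption; exact hGF h])).symm
        have hsF : s ∉ F := fun h => hcon (hfac F hF hGF v s hvF h)
        simp [hvF, hqF, hsF]; omega
      · simp [hvF]
    by_cases hvq : v = q
    · subst hvq
      right
      rintro F ⟨⟨hF, hGF⟩, hFne⟩
      rw [wt_add, wt_add, wt_add, wt_single, wt_single, wt_single, wt_single]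
      by_cases hvF : v ∈ F
      · have hpF : p ∉ F := fun h => hFne (fac1.2 F hF.1 (by
          intro t; simp; rintro (rfl | rfl | h) <;> [assumption; assumption; exact hGF h])).symm
        have hsF : s ∉ F := fun h => hnq (hfac F hF hGF v s hvF h)
        simp [hvF, hpF, hsF]; omega
      · simp [hvF]
    · left
      rintro F rfl
      rw [wt_add, wt_single (v := v)]
      simp [hvp, hvq, hv]

set_option maxHeartbeats 1600000 in
theorem Q : ∀ (k : ℕ) (G : Finset (Fin n)) (u v w : Fin n), d + 1 ≤ G.card + 2 + k → G.card + 2 ≤ d → u ≠ v →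
    insert u (insert v G) ∈ Δ.faces → insert w G ∈ Δ.faces →
    insert u (insert w G) ∈ Δ.faces ∨ insert v (insert w G) ∈ Δ.faces := by
  have hm := H.hm
  have hd := H.hd
  intro k
  induction k with
  | zero => intro G u v w h1 h2; omega
  | succ k ih =>
    intro G u v w hk hGd huv huvf hwf
    have hG : G ∈ Δ.faces := Δ.down_closed hwf (subset_insert _ _)
    by_cases hwG : w ∈ G
    · left; rw [insert_eq_of_mem hwG]; exact Δ.down_closed huvf (by intro z; clear * -; simp only [mem_insert]; tauto)
    by_cases huG : u ∈ G
    · left; rwa [insert_eq_of_mem (by simp [huG])]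
    by_cases hvG : v ∈ G
    · right; rwa [insert_eq_of_mem (by simp [hvG])]
    by_cases hwu : w = u
    · subst hwu; right; rwa [insert_comm]
    by_cases hwv : w = v
    · subst hwv; left; exact huvf
    -- closure
    have clos : ∀ (u v : Fin n), u ≠ v → u ∉ G → v ∉ G → insert u (insert v G) ∈ Δ.faces →
        ∀ p q, p ∉ G → q ∉ G → p ≠ q → insert p (insert q G) ∈ Δ.faces →
        insert u (insert p G) ∈ Δ.faces → 
        insert u (insert q G) ∈ Δ.faces ∨ insert v (insert q G) ∈ Δ.faces := by
      intro u v huv huG hvG huvf p q hp hq hpq hpqf hup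
      by_cases hpu : p = u
      · subst hpu; left; exact hpqf
      by_cases hpv : p = v
      · subst hpv; right; exact hpqf
      by_cases hqu : q = u
      · subst hqu; right; rwa [insert_comm]
      by_cases hqv : q = v
      · subst hqv; left; exact huvf
      by_cases hc : G.card + 2 = d
      · right
        exact H.path hc hvG huG hp hq (Ne.symm huv) (Ne.symm hpv) (Ne.symm hqv) (Ne.symm hpu)
          (Ne.symm hqu) hpq (by rwa [insert_comm]) hup hpqf
      obtain ⟨F, hF, hFs⟩ := exists_facet hup
      have hFc := H.facet_card hF
      have hcu : (insert u (insert p G)).card = G.card + 2 := by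
        rw [card_insert_of_notMem (by simp [Ne.symm hpu, huG]), card_insert_of_notMem hp]
      obtain ⟨t, htF, ht⟩ : ∃ t ∈ F, t ∉ insert u (insert p G) := by
        by_contra! h
        have := card_le_card (show F ⊆ _ from h)
        omega
      simp only [mem_insert, not_or] at ht
      obtain ⟨htu, htp, htG⟩ := ht
      have hupt : insert u (insert t (insert p G)) ∈ Δ.faces := Δ.down_closed hF.1 (by
        intro z hz
        simp only [mem_insert] at hz
        rcases hz with rfl | rfl | hz
        · exact hFs (by simp)
        · exact htF
        · exact hFs (by simp [hz]))
      have cp : (insert p G).card = G.card + 1 := card_insert_of_notMem hp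
      have cu : (insert u G).card = G.card + 1 := card_insert_of_notMem huG
      have ct : (insert t G).card = G.card + 1 := card_insert_of_notMem htG
      rcases ih (insert p G) u t q (by omega) (by omega) (Ne.symm htu) hupt
        (by rwa [insert_comm]) with h | h
      · left; exact Δ.down_closed h (by intro z; clear * -; simp only [mem_insert]; tauto)
      rcases ih (insert u G) p t v (by omega) (by omega) (Ne.symm htp)
        (Δ.down_closed hupt (by intro z; clear * -; simp only [mem_insert]; tauto)) (by rwa [insert_comm]) with h2 | h2
      · rcases ih (insert p G) u v q (by omega) (by omega) huv
          (Δ.down_closed h2 (by intro z; clear * -; simp only [mem_insert]; tauto)) (by rwa [insert_comm]) with h3 | h3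
        · left; exact Δ.down_closed h3 (by intro z; clear * -; simp only [mem_insert]; tauto)
        · right; exact Δ.down_closed h3 (by intro z; clear * -; simp only [mem_insert]; tauto)
      · rcases ih (insert t G) u v q (by omega) (by omega) huv
          (Δ.down_closed h2 (by intro z; clear * -; simp only [mem_insert]; tauto)) 
          (Δ.down_closed h (by intro z; clear * -; simp only [mem_insert]; tauto)) with h3 | h3
        · left; exact Δ.down_closed h3 (by intro z; clear * -; simp only [mem_insert]; tauto)
        · right; exact Δ.down_closed h3 (by intro z; clear * -; simp only [mem_insert]; tauto)
    by_contra hcon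
    have clos2 : ∀ p q, p ∉ G → q ∉ G → insert p (insert q G) ∈ Δ.faces →
        (insert u (insert p G) ∈ Δ.faces ∨ insert v (insert p G) ∈ Δ.faces) →
        (insert u (insert q G) ∈ Δ.faces ∨ insert v (insert q G) ∈ Δ.faces) := by
      intro p q hp hq hpq hh
      by_cases hpq' : p = q
      · rwa [← hpq']
      rcases hh with h | h
      · exact clos u v huv huG hvG huvf p q hp hq hpq' hpq h
      · exact (clos v u (Ne.symm huv) hvG huG (by rwa [insert_comm]) p q hp hq hpq' hpq h).symm
    have fsub : ∀ F, Δ.IsFacet F → G ⊆ F → ∀ x y, x ∈ F → y ∈ F → insert x (insert y G) ∈ Δ.faces := by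
      intro F hF hGF x y hx hy
      refine Δ.down_closed hF.1 ?_
      intro t; simp; rintro (rfl | rfl | h) <;> [assumption; assumption; exact hGF h]
    obtain ⟨F1, hF1, hF1s⟩ := exists_facet huvf
    obtain ⟨F2, hF2, hF2s⟩ := exists_facet hwf
    refine H.conn hG ⟨F2, hF2, (subset_insert _ _).trans hF2s, by rw [H.facet_card hF2]; omega⟩
      (fun F => (Δ.IsFacet F ∧ G ⊆ F) ∧ ∃ x ∈ F, x ∉ G ∧
        (insert u (insert x G) ∈ Δ.faces ∨ insert v (insert x G) ∈ Δ.faces))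
      (fun F => (Δ.IsFacet F ∧ G ⊆ F) ∧ ¬ ∃ x ∈ F, x ∉ G ∧
        (insert u (insert x G) ∈ Δ.faces ∨ insert v (insert x G) ∈ Δ.faces))
      (fun F => by rw [← and_or_left]; simp only [Classical.em, and_true]) ?_ ⟨F1, ⟨hF1, fun z hz => hF1s (by simp [hz])⟩, u, hF1s (by simp), huG, ?_⟩
      ⟨F2, ⟨hF2, (subset_insert _ _).trans hF2s⟩, ?_⟩
    · rintro A B ⟨⟨hA, hGA⟩, x, hxA, hxG, hx⟩ ⟨⟨hB, hGB⟩, hno⟩ z hz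
      rw [mem_inter] at hz
      by_contra hzG
      exact hno ⟨z, hz.2, hzG, clos2 x z hxG hzG (fsub A hA hGA x z hxA hz.1) hx⟩
    · right; rwa [insert_comm]
    · rintro ⟨x, hxF, hxG, hx⟩
      exact hcon (clos2 x w hxG hwG (fsub F2 hF2 ((subset_insert _ _).trans hF2s) x w hxF
        (hF2s (by simp))) hx)

theorem matroid : ∀ (k : ℕ) (X Y : Finset (Fin n)), (X \ Y).card ≤ k → X ∈ Δ.faces → Y ∈ Δ.faces →
    X.card < Y.card → ∃ y ∈ Y, y ∉ X ∧ insert y X ∈ Δ.faces := by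
  intro k
  induction k with
  | zero =>
    intro X Y hk hX hY hc
    have hXY : X ⊆ Y := by rw [← sdiff_eq_empty_iff_subset, ← card_eq_zero]; omega
    obtain ⟨y, hy, hyX⟩ := exists_mem_notMem_of_card_lt_card hc
    exact ⟨y, hy, hyX, Δ.down_closed hY (insert_subset hy hXY)⟩
  | succ k ih =>
    intro X Y hk hX hY hc
    by_cases hXY : X ⊆ Y
    · obtain ⟨y, hy, hyX⟩ := exists_mem_notMem_of_card_lt_card hc
      exact ⟨y, hy, hyX, Δ.down_closed hY (insert_subset hy hXY)⟩
    obtain ⟨x, hx, hxY⟩ := not_subset.1 hXY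
    have hxc := card_erase_add_one hx
    have hlt : ((X.erase x) \ Y).card < (X \ Y).card := card_lt_card (by
      refine ⟨sdiff_subset_sdiff (erase_subset _ _) subset_rfl, fun h => ?_⟩
      have := h (mem_sdiff.2 ⟨hx, hxY⟩)
      simp at this)
    obtain ⟨y1, hy1, hy1X, hf1⟩ := ih (X.erase x) Y (by omega)
      (Δ.down_closed hX (erase_subset _ _)) hY (by omega)
    have e1 : insert y1 (X.erase x) \ Y = (X.erase x) \ Y := insert_sdiff_of_mem _ hy1
    have c1 := card_insert_of_notMem hy1X
    obtain ⟨y2, hy2, hy2X, hf2⟩ := ih (insert y1 (X.erase x)) Y (by rw [e1]; omega) hf1 hY (by omega)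
    have c2 := card_insert_of_notMem hy2X
    have c3 := H.hmax _ hf2
    rw [mem_insert, not_or] at hy2X
    have hyn : ∀ y ∈ Y, y ∉ X.erase x → y ∉ X := by
      intro y hy hyX h
      refine hyX (mem_erase.2 ⟨?_, h⟩)
      rintro rfl; exact hxY hy
    rcases H.Q (d+1) (X.erase x) y2 y1 x (by omega) (by omega) hy2X.1 hf2 (by rwa [insert_erase hx]) with h | h
    · rw [insert_erase hx] at h; exact ⟨y2, hy2, hyn _ hy2 hy2X.2, h⟩
    · rw [insert_erase hx] at h; exact ⟨y1, hy1, hyn _ hy1 hy1X, h⟩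

theorem ext : ∀ (k : ℕ) (X Y : Finset (Fin n)), X.card + k = Y.card → X ∈ Δ.faces → Y ∈ Δ.faces →
    ∃ Z ∈ Δ.faces, X ⊆ Z ∧ Z ⊆ X ∪ Y ∧ Z.card = Y.card := by
  intro k
  induction k with
  | zero => intro X Y h hX _; exact ⟨X, hX, subset_rfl, subset_union_left, by omega⟩
  | succ k ih =>
    intro X Y h hX hY
    obtain ⟨y, hy, hyX, hf⟩ := H.matroid _ X Y le_rfl hX hY (by omega)
    obtain ⟨Z, hZ, h1, h2, h3⟩ := ih (insert y X) Y (by rw [card_insert_of_notMem hyX]; omega) hf hY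
    refine ⟨Z, hZ, (subset_insert _ _).trans h1, h2.trans ?_, h3⟩
    intro t; simp; rintro (rfl | h | h) <;> tauto

theorem ci : Δ.IsCompleteIntersection := by
  intro A B hA hB hAB
  rw [disjoint_left]
  intro v hvA hvB
  obtain ⟨u, huA, huB⟩ : ∃ u ∈ A, u ∉ B := by
    by_contra! h
    exact hA.2.1 (hB.2.2 A ((show A ⊆ B from h).ssubset_of_ne hAB))
  have huv : u ≠ v := by rintro rfl; exact huB hvB
  obtain ⟨F, hF, hAF⟩ := exists_facet (hA.2.2 _ (erase_ssubset huA))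
  have huF : u ∉ F := fun h => hA.2.1 (Δ.down_closed hF.1 (by
    rw [← insert_erase huA]; exact insert_subset h hAF))
  have hvF : v ∈ F := hAF (mem_erase.2 ⟨huv.symm, hvA⟩)
  have hFc := H.facet_card hF
  have cG := card_erase_add_one hvF
  have key : ∀ C, Δ.IsMinNonface C → v ∈ C → ∃ Z ∈ Δ.faces, C.erase v ⊆ Z ∧ Z ⊆ C.erase v ∪ F ∧ Z.card = d ∧ v ∉ Z := by
    intro C hC hvC
    have hf := hC.2.2 _ (erase_ssubset hvC)
    have hle := H.hmax _ hf
    obtain ⟨Z, hZ, h1, h2, h3⟩ := H.ext (d - (C.erase v).card) (C.erase v) F (by omega) hf hF.1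
    refine ⟨Z, hZ, h1, h2, by omega, fun h => hC.2.1 (Δ.down_closed hZ ?_)⟩
    rw [← insert_erase hvC]; exact insert_subset h h1
  obtain ⟨Z, hZ, hZ1, hZ2, hZ3, hZv⟩ := key A hA hvA
  have huG : u ∉ F.erase v := fun h => huF (mem_of_mem_erase h)
  have hZe : Z = insert u (F.erase v) := by
    refine eq_of_subset_of_card_le (fun t ht => ?_) (by rw [card_insert_of_notMem huG]; omega)
    have htv : t ≠ v := by rintro rfl; exact hZv ht
    by_cases htu : t = u
    · simp [htu]
    have := hZ2 ht
    rw [mem_union] at this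
    refine mem_insert_of_mem (mem_erase.2 ⟨htv, ?_⟩)
    rcases this with h | h
    · exact hAF (mem_erase.2 ⟨htu, mem_of_mem_erase h⟩)
    · exact h
  obtain ⟨W, hW, hW1, hW2, hW3, hWv⟩ := key B hB hvB
  obtain ⟨y, hyW, hyG, hyf⟩ := H.matroid _ (F.erase v) W le_rfl
    (Δ.down_closed hF.1 (erase_subset _ _)) hW (by omega)
  have hyv : y ≠ v := by rintro rfl; exact hWv hyW
  have hyB : y ∈ B := by
    have := hW2 hyW
    rw [mem_union] at this
    rcases this with h | h
    · exact mem_of_mem_erase h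
    · exact absurd (mem_erase.2 ⟨hyv, h⟩) hyG
  refine H.D2 (G := F.erase v) (by omega) (x := u) (y := v) (z := y) huG (by simp) hyG huv
    (by rintro rfl; exact huB hyB) hyv.symm (hZe ▸ hZ) (by rw [insert_erase hvF]; exact hF.1) hyf

end Hyp
end Cb

end

section

open Finset

namespace Cb
open MvPolynomial
variable {n : ℕ} (K : Type) [Field K]

def Up (p : (Fin n → ℕ) → Prop) : Prop := ∀ a b : Fin n → ℕ, (∀ i, a i ≤ b i) → p a → p b

/-- monomial ideal -/
noncomputable def MI (p : (Fin n → ℕ) → Prop) : Ideal (MvPolynomial (Fin n) K) :=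
  Ideal.span ((fun b : Fin n →₀ ℕ => monomial b (1:K)) '' {b | p b})

variable {K}

theorem mem_MI {p : (Fin n → ℕ) → Prop} (hp : Up p) {f : MvPolynomial (Fin n) K} :
    f ∈ MI K p ↔ ∀ b ∈ f.support, p b := by
  unfold MI
  rw [mem_ideal_span_monomial_image]
  refine forall₂_congr fun b _ => ⟨?_, fun h => ⟨b, h, le_rfl⟩⟩
  rintro ⟨a, ha, hab⟩
  exact hp a b hab ha

theorem monomial_mem_MI {p : (Fin n → ℕ) → Prop} (hp : Up p) {b : Fin n →₀ ℕ} :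
    monomial b (1:K) ∈ MI K p ↔ p b := by
  rw [mem_MI hp]
  simp

theorem MI_mono {p q : (Fin n → ℕ) → Prop} (h : ∀ a, p a → q a) : MI K p ≤ MI K q :=
  Ideal.span_mono (Set.image_mono fun b hb => h b hb)

theorem MI_congr {p q : (Fin n → ℕ) → Prop} (h : ∀ a, p a ↔ q a) : MI K p = MI K q :=
  le_antisymm (MI_mono fun a => (h a).1) (MI_mono fun a => (h a).2)

theorem Up.and {p q : (Fin n → ℕ) → Prop} (hp : Up p) (hq : Up q) : Up (fun a => p a ∧ q a) :=
  fun a b h ⟨h1, h2⟩ => ⟨hp a b h h1, hq a b h h2⟩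

theorem Up.or {p q : (Fin n → ℕ) → Prop} (hp : Up p) (hq : Up q) : Up (fun a => p a ∨ q a) :=
  fun a b h h1 => h1.imp (hp a b h) (hq a b h)

theorem MI_inf {p q : (Fin n → ℕ) → Prop} (hp : Up p) (hq : Up q) :
    MI K p ⊓ MI K q = MI K (fun a => p a ∧ q a) := by
  ext f
  rw [Ideal.mem_inf, mem_MI hp, mem_MI hq, mem_MI (hp.and hq)]
  exact ⟨fun h b hb => ⟨h.1 b hb, h.2 b hb⟩, fun h => ⟨fun b hb => (h b hb).1, fun b hb => (h b hb).2⟩⟩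

theorem MI_sup (p q : (Fin n → ℕ) → Prop) :
    MI K p ⊔ MI K q = MI K (fun a => p a ∨ q a) := by
  unfold MI
  rw [← Ideal.span_union, ← Set.image_union]
  rfl

theorem monomial_mul_mem {p : (Fin n → ℕ) → Prop} (hp : Up p) {c : Fin n →₀ ℕ}
    {f : MvPolynomial (Fin n) K} :
    monomial c (1:K) * f ∈ MI K p ↔ ∀ b ∈ f.support, p (c + b : Fin n →₀ ℕ) := by
  rw [mem_MI hp]
  constructor
  · intro h b hb
    apply h
    rw [mem_support_iff, coeff_monomial_mul, one_mul]
    exact mem_support_iff.1 hb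
  · intro h b hb
    rw [mem_support_iff, coeff_monomial_mul'] at hb
    split_ifs at hb with hcb
    · have := h (b - c) (by rw [mem_support_iff]; simpa using hb)
      rwa [add_tsub_cancel_of_le hcb] at this
    · exact absurd rfl hb

theorem Up.pow (Δ : SimComplex n) (m : ℕ) (G : Finset (Fin n)) : Up (Pow Δ m G) := by
  rintro a b hab ⟨F, hF, hc⟩
  exact ⟨F, hF, fun i hi => (hc i hi).trans (hab i)⟩

theorem wt_mono {F : Finset (Fin n)} {a b : Fin n → ℕ} (h : ∀ i, a i ≤ b i) : wt F a ≤ wt F b :=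
  sum_le_sum fun i _ => h i

theorem Up.je (m : ℕ) (E : Finset (Fin n) → Prop) : Up (JE m E) :=
  fun _ _ hab h F hF => (h F hF).trans (wt_mono hab)

theorem faceMonomial_eq (F : Finset (Fin n)) :
    faceMonomial K F = monomial (Finsupp.equivFunOnFinite.symm (fun i => if i ∈ F then 1 else 0)) (1:K) := by
  classical
  unfold faceMonomial
  rw [monomial_eq, C_1, one_mul, Finsupp.prod_fintype _ _ (by simp)]
  simp

theorem prod_faceMonomial {m : ℕ} (F : Fin m → Finset (Fin n)) :
    ∏ j, faceMonomial K (F j) = monomial (Finsupp.equivFunOnFinite.symm (cnt F)) (1:K) := by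
  simp_rw [faceMonomial_eq]
  rw [← monomial_sum_one]
  congr 2
  ext i
  simp [cnt, Finsupp.finsetSum_apply]

theorem SR_pow (Δ : SimComplex n) (m : ℕ) : SRIdeal K Δ ^ m = MI K (Pow Δ m ∅) := by
  apply le_antisymm
  · induction m with
    | zero =>
      rw [pow_zero, Ideal.one_eq_top, top_le_iff, Ideal.eq_top_iff_one]
      have := (monomial_mem_MI (K := K) (Up.pow Δ 0 ∅) (b := 0)).2
        ⟨Fin.elim0, fun j => j.elim0, fun i _ => by simp [cnt]⟩
      simpa using this
    | succ m ih =>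
      rw [pow_succ]
      refine (Ideal.mul_mono_left ih).trans ?_
      unfold MI SRIdeal
      rw [Ideal.span_mul_span', Ideal.span_le]
      rintro _ ⟨_, ⟨b, ⟨F, hF, hc⟩, rfl⟩, _, ⟨A, hA, rfl⟩, rfl⟩
      show _ * _ ∈ MI K (Pow Δ (m+1) ∅)
      simp only
      rw [faceMonomial_eq, monomial_mul_mem (Up.pow _ _ _)]
      intro c hc2
      have hc2 := Finset.mem_singleton.1 (support_monomial_subset hc2)
      subst hc2
      refine ⟨Fin.cons A F, fun j => ?_, fun i hi => ?_⟩
      · refine Fin.cases ?_ (fun j => ?_) j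
        · simpa using hA
        · simpa using hF j
      · have := hc i hi
        simp only [cnt, card_filter] at this ⊢
        rw [Fin.sum_univ_succ]
        simp only [Fin.cons_zero, Fin.cons_succ, Finsupp.coe_add, Pi.add_apply, Finsupp.equivFunOnFinite_symm_apply_apply]
        omega
  · unfold MI
    rw [Ideal.span_le]
    rintro _ ⟨b, ⟨F, hF, hc⟩, rfl⟩
    have h1 : ∏ j, faceMonomial K (F j) ∈ SRIdeal K Δ ^ m := by
      have := Ideal.prod_mem_prod (s := (univ : Finset (Fin m))) (I := fun _ => SRIdeal K Δ)
        (x := fun j => faceMonomial K (F j)) (fun j _ => Ideal.subset_span ⟨F j, hF j, rfl⟩)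
      simpa using this
    have h2 : monomial b (1:K) = monomial (b - Finsupp.equivFunOnFinite.symm (cnt F)) (1:K) * ∏ j, faceMonomial K (F j) := by
      rw [prod_faceMonomial, monomial_mul, one_mul, tsub_add_cancel_of_le]
      intro i
      exact hc i (by simp)
    simp only [SetLike.mem_coe]
    rw [h2]
    exact Ideal.mul_mem_left _ _ h1

end Cb

end

section

open CategoryTheory Opposite Limits

namespace Hm
variable {R : Type} [CommRing R]

section
variable {A B C : Type} [AddCommGroup A] [AddCommGroup B] [AddCommGroup C] [Module R A] [Module R B]
  [Module R C] (f : A →ₗ[R] B) (g : B →ₗ[R] C)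

theorem ses_w (he : Function.Exact f g) : ModuleCat.ofHom f ≫ ModuleCat.ofHom g = 0 := by
  ext x
  simpa using (he (f x)).2 ⟨x, rfl⟩

theorem ses (hf : Function.Injective f) (he : Function.Exact f g) (hg : Function.Surjective g) :
    (ShortComplex.mk (ModuleCat.ofHom f) (ModuleCat.ofHom g) (ses_w f g he)).ShortExact :=
  ModuleCat.shortComplex_shortExact _ he hf hg
end

/-- colon sequence maps -/
def colF (Q Q' : Ideal R) (y : R) (h : ∀ f, y * f ∈ Q ↔ f ∈ Q') : (R ⧸ Q') →ₗ[R] (R ⧸ Q) :=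
  Submodule.mapQ Q' Q (LinearMap.mulLeft R y) (fun f hf => (h f).2 hf)

def colG (Q : Ideal R) (y : R) : (R ⧸ Q) →ₗ[R] (R ⧸ (Q ⊔ Ideal.span {y})) :=
  Submodule.factor le_sup_left

theorem colF_mk (Q Q' : Ideal R) (y : R) (h : ∀ f, y * f ∈ Q ↔ f ∈ Q') (f : R) :
    colF Q Q' y h (Submodule.Quotient.mk f) = Submodule.Quotient.mk (y * f) := rfl

theorem colG_mk (Q : Ideal R) (y : R) (f : R) :
    colG Q y (Submodule.Quotient.mk f) = Submodule.Quotient.mk f := rfl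

theorem col_ses (Q Q' : Ideal R) (y : R) (h : ∀ f, y * f ∈ Q ↔ f ∈ Q') :
    Function.Injective (colF Q Q' y h) ∧ Function.Exact (colF Q Q' y h) (colG Q y) ∧
      Function.Surjective (colG Q y) := by
  refine ⟨?_, ?_, ?_⟩
  · rw [injective_iff_map_eq_zero]
    intro a ha
    obtain ⟨f, rfl⟩ := Submodule.Quotient.mk_surjective _ a
    rw [colF_mk, Submodule.Quotient.mk_eq_zero] at ha
    rw [Submodule.Quotient.mk_eq_zero]
    exact (h f).1 ha
  · intro b
    obtain ⟨f, rfl⟩ := Submodule.Quotient.mk_surjective _ b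
    rw [colG_mk, Submodule.Quotient.mk_eq_zero]
    constructor
    · intro hf
      obtain ⟨q, hq, z, hz, rfl⟩ := Submodule.mem_sup.1 hf
      obtain ⟨c, rfl⟩ := Ideal.mem_span_singleton'.1 hz
      refine ⟨Submodule.Quotient.mk c, ?_⟩
      rw [colF_mk, Submodule.Quotient.eq]
      have : y * c - (q + c * y) = -q := by ring
      rw [this]; exact neg_mem hq
    · rintro ⟨a, ha⟩
      obtain ⟨c, rfl⟩ := Submodule.Quotient.mk_surjective _ a
      rw [colF_mk, Submodule.Quotient.eq] at ha
      have : f = -(y * c - f) + c * y := by ring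
      rw [this]
      exact Submodule.add_mem_sup (neg_mem ha) (Ideal.mem_span_singleton'.2 ⟨c, rfl⟩)
  · intro b
    obtain ⟨f, rfl⟩ := Submodule.Quotient.mk_surjective _ b
    exact ⟨Submodule.Quotient.mk f, rfl⟩

/-- Mayer-Vietoris maps -/
def mvF (I J : Ideal R) : (R ⧸ (I ⊓ J)) →ₗ[R] (R ⧸ I) × (R ⧸ J) :=
  LinearMap.prod (Submodule.factor inf_le_left) (Submodule.factor inf_le_right)

def mvG (I J : Ideal R) : ((R ⧸ I) × (R ⧸ J)) →ₗ[R] (R ⧸ (I ⊔ J)) :=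
  (Submodule.factor le_sup_left).comp (LinearMap.fst R _ _) -
    (Submodule.factor le_sup_right).comp (LinearMap.snd R _ _)

theorem mvF_mk (I J : Ideal R) (f : R) :
    mvF I J (Submodule.Quotient.mk f) = (Submodule.Quotient.mk f, Submodule.Quotient.mk f) := rfl

theorem mvG_mk (I J : Ideal R) (f g : R) :
    mvG I J (Submodule.Quotient.mk f, Submodule.Quotient.mk g) = Submodule.Quotient.mk (f - g) := rfl

theorem mv_ses (I J : Ideal R) : Function.Injective (mvF I J) ∧ Function.Exact (mvF I J) (mvG I J) ∧
      Function.Surjective (mvG I J) := by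
  refine ⟨?_, ?_, ?_⟩
  · rw [injective_iff_map_eq_zero]
    intro a ha
    obtain ⟨f, rfl⟩ := Submodule.Quotient.mk_surjective _ a
    rw [mvF_mk, Prod.mk_eq_zero, Submodule.Quotient.mk_eq_zero, Submodule.Quotient.mk_eq_zero] at ha
    rw [Submodule.Quotient.mk_eq_zero]
    exact ha
  · rintro ⟨b, c⟩
    obtain ⟨f, rfl⟩ := Submodule.Quotient.mk_surjective _ b
    obtain ⟨g, rfl⟩ := Submodule.Quotient.mk_surjective _ c
    rw [mvG_mk, Submodule.Quotient.mk_eq_zero]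
    constructor
    · intro hf
      obtain ⟨q, hq, z, hz, hh⟩ := Submodule.mem_sup.1 hf
      refine ⟨Submodule.Quotient.mk (f - q), ?_⟩
      rw [mvF_mk, Prod.mk.injEq, Submodule.Quotient.eq, Submodule.Quotient.eq]
      refine ⟨?_, ?_⟩
      · have : f - q - f = -q := by ring
        rw [this]; exact neg_mem hq
      · have : f - q - g = z := by linear_combination -hh
        rw [this]; exact hz
    · rintro ⟨a, ha⟩
      obtain ⟨c, rfl⟩ := Submodule.Quotient.mk_surjective _ a
      rw [mvF_mk, Prod.mk.injEq, Submodule.Quotient.eq, Submodule.Quotient.eq] at ha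
      have : f - g = -(c - f) + (c - g) := by ring
      rw [this]
      exact Submodule.add_mem_sup (neg_mem ha.1) ha.2
  · intro b
    obtain ⟨f, rfl⟩ := Submodule.Quotient.mk_surjective _ b
    exact ⟨(Submodule.Quotient.mk f, Submodule.Quotient.mk 0), by rw [mvG_mk, sub_zero]⟩

theorem Kills.factor {J Q Q' : Ideal R} (hQ : Q ≤ Q') {y b : R} (hy : ∀ f ∈ Q', y * f ∈ Q) {i : ℕ}
    (h : Kills J b i (ModuleCat.of R (R ⧸ Q))) : Kills J (y * b) i (ModuleCat.of R (R ⧸ Q')) := by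
  have hs := ses (LinearMap.ker (Submodule.factor hQ)).subtype (Submodule.factor hQ)
    Subtype.val_injective (LinearMap.exact_subtype_ker_map _) (Submodule.factor_surjective hQ)
  refine Kills.three hs (b := b) h (Kills.ann J y _ _ ?_)
  rintro ⟨u, hu⟩
  obtain ⟨f, rfl⟩ := Submodule.Quotient.mk_surjective _ u
  have hu2 : f ∈ Q' := by
    rw [LinearMap.mem_ker] at hu
    exact (Submodule.Quotient.mk_eq_zero _).1 hu
  apply Subtype.ext
  show y • (Submodule.Quotient.mk f : R ⧸ Q) = 0
  rw [← Submodule.Quotient.mk_smul, Submodule.Quotient.mk_eq_zero]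
  exact hy f hu2

theorem Kills.regular {J Q : Ideal R} {y b : R} (hy : ∀ f, y * f ∈ Q → f ∈ Q) {i : ℕ}
    (h : Kills J b i (ModuleCat.of R (R ⧸ Q))) (h' : Kills J b (i+1) (ModuleCat.of R (R ⧸ Q))) :
    Kills J (b * b) i (ModuleCat.of R (R ⧸ (Q ⊔ Ideal.span {y}))) := by
  have hh : ∀ f, y * f ∈ Q ↔ f ∈ Q := fun f => ⟨hy f, fun h => Ideal.mul_mem_left _ _ h⟩
  obtain ⟨h1, h2, h3⟩ := col_ses Q Q y hh
  exact Kills.three (ses _ _ h1 h2 h3) h h'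

theorem Kills.mv {J I I' : Ideal R} {b : R} 
    (h : Kills J b 1 (ModuleCat.of R (R ⧸ (I ⊓ I'))))
    (h1 : ∀ k, ∀ f : R, (∀ y ∈ J ^ k, y * f ∈ I) → f ∈ I)
    (h2 : ∀ k, ∀ f : R, (∀ y ∈ J ^ k, y * f ∈ I') → f ∈ I') :
    Kills J (b * 1) 0 (ModuleCat.of R (R ⧸ (I ⊔ I'))) := by
  obtain ⟨e1, e2, e3⟩ := mv_ses I I'
  refine Kills.three (ses _ _ e1 e2 e3) (Kills.one_zero ?_) h
  rintro k ⟨u, v⟩ huv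
  obtain ⟨f, rfl⟩ := Submodule.Quotient.mk_surjective _ u
  obtain ⟨g, rfl⟩ := Submodule.Quotient.mk_surjective _ v
  have huv2 : ∀ y ∈ J ^ k, y * f ∈ I ∧ y * g ∈ I' := by
    intro y hy
    have h3 : ((Submodule.Quotient.mk (y * f) : R ⧸ I), (Submodule.Quotient.mk (y * g) : R ⧸ I')) = 0 := huv y hy
    rwa [Prod.mk_eq_zero, Submodule.Quotient.mk_eq_zero, Submodule.Quotient.mk_eq_zero] at h3
  show ((Submodule.Quotient.mk f : R ⧸ I), (Submodule.Quotient.mk g : R ⧸ I')) = 0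
  rw [Prod.mk_eq_zero, Submodule.Quotient.mk_eq_zero, Submodule.Quotient.mk_eq_zero]
  exact ⟨h1 k f fun y hy => (huv2 y hy).1, h2 k g fun y hy => (huv2 y hy).2⟩

theorem Kills.zero_mem {J Q : Ideal R} {b f : R} (h : Kills J b 0 (ModuleCat.of R (R ⧸ Q)))
    {k : ℕ} (hk : ∀ y ∈ J ^ k, y * f ∈ Q) : b * f ∈ Q := by
  have := Kills.zero h (k := k) (u := (Submodule.Quotient.mk f : R ⧸ Q)) (fun y hy =>
    (Submodule.Quotient.mk_eq_zero _).2 (hk y hy))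
  exact (Submodule.Quotient.mk_eq_zero _).1 this

end Hm

end

section

open Finset

namespace Cb
open MvPolynomial
variable {n : ℕ} {K : Type} [Field K]

/-- function to finsupp -/
noncomputable def fs (a : Fin n → ℕ) : Fin n →₀ ℕ := Finsupp.equivFunOnFinite.symm a

theorem fs_apply (a : Fin n → ℕ) (i : Fin n) : fs a i = a i := rfl
theorem coe_fs (a : Fin n → ℕ) : (⇑(fs a) : Fin n → ℕ) = a := rfl

theorem pow_of_vars (Q : Ideal (MvPolynomial (Fin n) K)) (f : MvPolynomial (Fin n) K)
    (h : ∀ v : Fin n, ∃ k : ℕ, X v ^ k * f ∈ Q) : ∃ k, ∀ y ∈ maxIdeal K n ^ k, y * f ∈ Q := by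
  let C : Ideal (MvPolynomial (Fin n) K) :=
    Submodule.comap (LinearMap.mulRight (MvPolynomial (Fin n) K) f) Q
  have hC : ∀ y, y ∈ C ↔ y * f ∈ Q := fun y => Iff.rfl
  have hle : maxIdeal K n ≤ C.radical := by
    unfold maxIdeal
    rw [Ideal.span_le]
    rintro _ ⟨v, rfl⟩
    obtain ⟨k, hk⟩ := h v
    exact ⟨k, hk⟩
  obtain ⟨k, hk⟩ := Ideal.exists_pow_le_of_le_radical_of_fg hle (IsNoetherian.noetherian _)
  exact ⟨k, fun y hy => (hC y).1 (hk hy)⟩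

theorem X_mem_max (v : Fin n) : (X v : MvPolynomial (Fin n) K) ∈ maxIdeal K n :=
  Ideal.subset_span ⟨v, rfl⟩

theorem X_pow_mul_mem {p : (Fin n → ℕ) → Prop} (hp : Up p) (v : Fin n) (k : ℕ)
    (f : MvPolynomial (Fin n) K) :
    X v ^ k * f ∈ MI K p ↔ ∀ b ∈ f.support, p (⇑b + Pi.single v k) := by
  rw [X_pow_eq_monomial, monomial_mul_mem hp]
  refine forall₂_congr fun b _ => ?_
  rw [add_comm, Finsupp.coe_add, Finsupp.single_eq_pi_single]

theorem X_pow_mul_fs {p : (Fin n → ℕ) → Prop} (hp : Up p) (v : Fin n) (k : ℕ) (a : Fin n → ℕ) :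
    X v ^ k * monomial (fs a) (1:K) ∈ MI K p ↔ p (a + Pi.single v k) := by
  rw [X_pow_mul_mem hp]
  simp [coe_fs]

theorem tors_free {p : (Fin n → ℕ) → Prop} (hp : Up p)
    (h : ∀ b, ¬ p b → ∃ v, ∀ k, ¬ p (b + Pi.single v k)) (k : ℕ) (f : MvPolynomial (Fin n) K)
    (hf : ∀ y ∈ maxIdeal K n ^ k, y * f ∈ MI K p) : f ∈ MI K p := by
  rw [mem_MI hp]
  intro b hb
  by_contra hpb
  obtain ⟨v, hv⟩ := h b hpb
  exact hv k ((X_pow_mul_mem hp v k f).1 (hf _ (Ideal.pow_mem_pow (X_mem_max v) k)) b hb)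

/-- Mayer-Vietoris consequence -/
theorem mv_mem {p q : (Fin n → ℕ) → Prop} (hp : Up p) (hq : Up q) {e : Fin n → ℕ}
    (h : Hm.Kills (maxIdeal K n) (monomial (fs e) (1:K)) 1
      (ModuleCat.of _ (MvPolynomial (Fin n) K ⧸ MI K (fun a => p a ∧ q a))))
    (h1 : ∀ b, ¬ p b → ∃ v, ∀ k, ¬ p (b + Pi.single v k))
    (h2 : ∀ b, ¬ q b → ∃ v, ∀ k, ¬ q (b + Pi.single v k)) (a : Fin n → ℕ)
    (ha : ∀ v, ∃ k, p (a + Pi.single v k) ∨ q (a + Pi.single v k)) :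
    p (e + a) ∨ q (e + a) := by
  rw [← MI_inf hp hq] at h
  have h3 := Hm.Kills.mv h (tors_free hp h1) (tors_free hq h2)
  rw [mul_one, MI_sup] at h3
  obtain ⟨k, hk⟩ := pow_of_vars (MI K (fun a => p a ∨ q a)) (monomial (fs a) (1:K)) (fun v => by
    obtain ⟨k, hk⟩ := ha v
    exact ⟨k, (X_pow_mul_fs (hp.or hq) v k a).2 hk⟩)
  have h4 := Hm.Kills.zero_mem h3 hk
  rw [monomial_mul, one_mul, monomial_mem_MI (hp.or hq)] at h4
  exact h4

theorem zero_mem' {p : (Fin n → ℕ) → Prop} (hp : Up p) {e : Fin n → ℕ}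
    (h : Hm.Kills (maxIdeal K n) (monomial (fs e) (1:K)) 0
      (ModuleCat.of _ (MvPolynomial (Fin n) K ⧸ MI K p))) (a : Fin n → ℕ)
    (ha : ∀ v, ∃ k, p (a + Pi.single v k)) : p (e + a) := by
  obtain ⟨k, hk⟩ := pow_of_vars (MI K p) (monomial (fs a) (1:K)) (fun v => by
    obtain ⟨k, hk⟩ := ha v
    exact ⟨k, (X_pow_mul_fs hp v k a).2 hk⟩)
  have h4 := Hm.Kills.zero_mem h hk
  rw [monomial_mul, one_mul, monomial_mem_MI hp] at h4
  exact h4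

def big (G : Finset (Fin n)) (N : ℕ) (b : Fin n → ℕ) : Prop := ∃ w ∈ G, N ≤ b w

theorem Up.big (G : Finset (Fin n)) (N : ℕ) : Up (big G N) :=
  fun _ _ h ⟨w, hw, hN⟩ => ⟨w, hw, hN.trans (h w)⟩

theorem MI_X_pow (v : Fin n) (N : ℕ) : MI K (fun b : Fin n → ℕ => N ≤ b v) = Ideal.span {X v ^ N} := by
  ext f
  rw [mem_MI (fun a b h h1 => le_trans h1 (h v)), X_pow_eq_monomial,
    show ({monomial (Finsupp.single v N) (1:K)} : Set (MvPolynomial (Fin n) K)) =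
      (fun b : Fin n →₀ ℕ => monomial b (1:K)) '' {Finsupp.single v N} by simp,
    mem_ideal_span_monomial_image]
  simp [Finsupp.single_le_iff]

variable {Δ : SimComplex n} {m d : ℕ}

theorem pow_congr {G : Finset (Fin n)} {a b : Fin n → ℕ} (h : ∀ i ∉ G, a i = b i) :
    Pow Δ m G a ↔ Pow Δ m G b := by
  unfold Pow
  refine exists_congr fun F => and_congr_right fun _ => forall₂_congr fun i hi => by rw [h i hi]

/-- `c` times the indicator of `G` -/
def ind (G : Finset (Fin n)) (c : ℕ) : Fin n → ℕ := fun i => if i ∈ G then c else 0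

theorem ind_pow (G : Finset (Fin n)) (c : ℕ) : (monomial (fs (ind G 1)) (1:K)) ^ c = monomial (fs (ind G c)) (1:K) := by
  rw [monomial_pow, one_pow]
  congr 2
  ext i
  simp only [Finsupp.smul_apply, fs_apply, ind]
  split_ifs <;> simp

theorem pow_mono_empty {G : Finset (Fin n)} {a : Fin n → ℕ} (h : Pow Δ m ∅ a) : Pow Δ m G a := by
  obtain ⟨F, hF, hc⟩ := h
  exact ⟨F, hF, fun i _ => hc i (by simp)⟩

theorem kills_G (hK : ∀ i < d, ∀ v : Fin n, Hm.Kills (maxIdeal K n) (X v) i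
      (ModuleCat.of _ (MvPolynomial (Fin n) K ⧸ MI K (Pow Δ m ∅))))
    (G : Finset (Fin n)) (hG : G.Nonempty) (N : ℕ) (W : Finset (Fin n)) : W ⊆ G →
    ∀ i, i + W.card < d → Hm.Kills (maxIdeal K n) (monomial (fs (ind G ((m + 1) * 2 ^ W.card))) (1:K)) i
      (ModuleCat.of _ (MvPolynomial (Fin n) K ⧸ MI K (fun b => Pow Δ m G b ∨ big W N b))) := by
  classical
  induction W using Finset.induction_on with
  | empty =>
    intro _ i hi
    obtain ⟨v, hv⟩ := hG
    have h1 := (hK i (by simpa using hi) v).mul (∏ i ∈ G.erase v, X i)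
    rw [mul_comm, mul_prod_erase G (fun i => (X i : MvPolynomial (Fin n) K)) hv] at h1
    change Hm.Kills _ (faceMonomial K G) _ _ at h1
    rw [faceMonomial_eq] at h1
    change Hm.Kills _ (monomial (fs (ind G 1)) (1:K)) _ _ at h1
    rw [MI_congr (q := Pow Δ m G) (fun a => by simp [big])]
    have h2 := Hm.Kills.factor (Q' := MI K (Pow Δ m G)) (MI_mono fun a => pow_mono_empty)
      (y := (monomial (fs (ind G 1)) (1:K))^m) ?_ h1
    · rw [← pow_succ, ind_pow] at h2
      simpa using h2
    · intro f hf
      rw [ind_pow, monomial_mul_mem (Up.pow _ _ _)]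
      intro b hb
      obtain ⟨F, hF, hc⟩ := (mem_MI (Up.pow _ _ _)).1 hf b hb
      refine ⟨F, hF, fun i _ => ?_⟩
      by_cases hi : i ∈ G
      · simp [fs_apply, ind, hi]
        have := cnt_le F i; omega
      · simp [fs_apply, ind, hi]; exact hc i hi
  | insert v W hv ih =>
    intro hW i hi
    rw [card_insert_of_notMem hv] at hi ⊢
    have hvG : v ∈ G := hW (mem_insert_self _ _)
    have hWG : W ⊆ G := (subset_insert _ _).trans hW
    have hup : Up (fun b => Pow Δ m G b ∨ big W N b) := (Up.pow _ _ _).or (Up.big _ _)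
    have h1 := Hm.Kills.regular (y := X v ^ N) ?_ (ih hWG i (by omega)) (ih hWG (i+1) (by omega))
    · rw [← MI_X_pow, MI_sup, ← pow_two, ← ind_pow, ← pow_mul, ind_pow, mul_assoc, ← pow_succ] at h1
      rw [MI_congr (q := fun b => (Pow Δ m G b ∨ big W N b) ∨ N ≤ b v) (fun a => by
        simp only [big, mem_insert, exists_eq_or_imp, or_assoc]
        rw [or_comm (a := N ≤ a v)])]
      exact h1
    · intro f hf
      rw [X_pow_mul_mem hup] at hf
      rw [mem_MI hup]
      intro b hb
      rcases hf b hb with h | ⟨w, hw, h⟩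
      · left
        refine (pow_congr fun i hi => ?_).1 h
        have : i ≠ v := by rintro rfl; exact hi hvG
        simp [this]
      · right
        have : w ≠ v := by rintro rfl; exact hv hw
        exact ⟨w, hw, by simpa [this] using h⟩

/-- zero out on `G` -/
def zo (G : Finset (Fin n)) (a : Fin n → ℕ) : Fin n → ℕ := fun i => if i ∈ G then 0 else a i

theorem wt_congr {F : Finset (Fin n)} {a b : Fin n → ℕ} (h : ∀ i ∉ F, a i = b i) : wt F a = wt F b :=
  sum_congr rfl fun i hi => h i (by simpa using hi)

theorem je_congr {E : Finset (Fin n) → Prop} {G : Finset (Fin n)} (hE : ∀ F, E F → G ⊆ F)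
    {a b : Fin n → ℕ} (h : ∀ i ∉ G, a i = b i) : JE m E a ↔ JE m E b := by
  unfold JE
  refine forall₂_congr fun F hF => ?_
  rw [wt_congr fun i hi => h i fun h => hi (hE F hF h)]

theorem h0_of_kills (hmax : ∀ F ∈ Δ.faces, F.card ≤ d)
    (hK : ∀ i < d, ∀ v : Fin n, Hm.Kills (maxIdeal K n) (X v) i
      (ModuleCat.of _ (MvPolynomial (Fin n) K ⧸ MI K (Pow Δ m ∅))))
    (G : Finset (Fin n)) (hGf : G ∈ Δ.faces) (hG : G.Nonempty) (hnf : ¬ Δ.IsFacet G) : H0 Δ m G := by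
  intro a ha
  have hlt : G.card < d := by
    obtain ⟨F, hF, hGF⟩ := exists_facet hGf
    have : G ≠ F := by rintro rfl; exact hnf hF
    have := card_lt_card (hGF.ssubset_of_ne this)
    have := hmax F hF.1
    omega
  set c := (m + 1) * 2 ^ G.card with hc
  have h1 := kills_G hK G hG (c+1) G subset_rfl 0 (by omega)
  have h2 := zero_mem' ((Up.pow _ _ _).or (Up.big _ _)) h1 (zo G a) ?_
  · rcases h2 with h2 | ⟨w, hw, h2⟩
    · refine (pow_congr fun i hi => ?_).1 h2
      simp [ind, zo, hi]
    · simp [ind, zo, hw] at h2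
      omega
  · intro v
    by_cases hv : v ∈ G
    · exact ⟨c+1, Or.inr ⟨v, hv, by simp⟩⟩
    · obtain ⟨k, hk⟩ := ha v hv
      refine ⟨k, Or.inl ((pow_congr fun i hi => ?_).1 hk)⟩
      simp [zo, hi]

theorem h1_of_kills (hmax : ∀ F ∈ Δ.faces, F.card ≤ d)
    (hK : ∀ i < d, ∀ v : Fin n, Hm.Kills (maxIdeal K n) (X v) i
      (ModuleCat.of _ (MvPolynomial (Fin n) K ⧸ MI K (Pow Δ m ∅))))
    (G : Finset (Fin n)) (hGf : G ∈ Δ.faces) (hG : G.Nonempty) : H1 Δ m G := by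
  rintro ⟨F0, hF0, hGF0, hF0c⟩ E1 E2 hE a ha
  have hlt : 1 + G.card < d := by
    have := hmax F0 hF0.1
    omega
  set c := (m + 1) * 2 ^ G.card with hc
  have h1 := kills_G hK G hG (c+1) G subset_rfl 1 (by omega)
  have hE1 : ∀ F, E1 F → G ⊆ F := fun F hF => ((hE F).2 (Or.inl hF)).2
  have hE2 : ∀ F, E2 F → G ⊆ F := fun F hF => ((hE F).2 (Or.inr hF)).2
  have htf : ∀ E : Finset (Fin n) → Prop, (∀ F, E F → Δ.IsFacet F ∧ G ⊆ F) → 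
      ∀ b, ¬ (JE m E b ∨ big G (c+1) b) → ∃ v, ∀ k, ¬ (JE m E (b + Pi.single v k) ∨ big G (c+1) (b + Pi.single v k)) := by
    intro E hE b hb
    rw [not_or] at hb
    obtain ⟨hb1, hb2⟩ := hb
    simp only [JE, not_forall] at hb1
    obtain ⟨F, hF, hb1⟩ := hb1
    obtain ⟨hFf, hGF⟩ := hE F hF
    have hne : ¬ F ⊆ G := by
      intro h
      have h1 : G = F := Subset.antisymm hGF h
      subst h1
      have := hFf.2 F0 hF0.1 hGF0
      subst this
      omega
    obtain ⟨v, hvF, hvG⟩ := not_subset.1 hne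
    refine ⟨v, fun k h => ?_⟩
    rcases h with h | ⟨w, hw, h⟩
    · have := h F hF
      rw [wt_add, wt_single] at this
      simp [hvF] at this
      exact hb1 this
    · have : w ≠ v := by rintro rfl; exact hvG hw
      exact hb2 ⟨w, hw, by simpa [this] using h⟩
  rw [MI_congr (q := fun b => (JE m E1 b ∨ big G (c+1) b) ∧ (JE m E2 b ∨ big G (c+1) b)) ?_] at h1
  · have h2 := mv_mem ((Up.je _ _).or (Up.big _ _)) ((Up.je _ _).or (Up.big _ _)) h1
      (htf E1 fun F hF => (hE F).2 (Or.inl hF)) (htf E2 fun F hF => (hE F).2 (Or.inr hF)) (zo G a) ?_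
    · have hnb : ¬ big G (c+1) (ind G c + zo G a) := by
        rintro ⟨w, hw, h2⟩
        simp [ind, zo, hw] at h2
      have h2' : (JE m E1 (ind G c + zo G a) ∨ big G (c+1) (ind G c + zo G a)) ∨
          (JE m E2 (ind G c + zo G a) ∨ big G (c+1) (ind G c + zo G a)) := h2
      have h3 : JE m E1 (ind G c + zo G a) ∨ JE m E2 (ind G c + zo G a) := by tauto
      refine h3.imp (fun h => (je_congr hE1 fun i hi => ?_).1 h) (fun h => (je_congr hE2 fun i hi => ?_).1 h)
      · simp [ind, zo, hi]
      · simp [ind, zo, hi]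
    · intro v
      by_cases hv : v ∈ G
      · exact ⟨c+1, Or.inl (Or.inr ⟨v, hv, by simp⟩)⟩
      · obtain ⟨k, hk⟩ := ha v hv
        refine ⟨k, hk.imp (fun h => Or.inl ((je_congr hE1 fun i hi => ?_).1 h))
          (fun h => Or.inl ((je_congr hE2 fun i hi => ?_).1 h))⟩
        · simp [zo, hi]
        · simp [zo, hi]
  · intro b
    have : Pow Δ m G b ↔ JE m E1 b ∧ JE m E2 b := by
      constructor
      · intro h
        exact ⟨fun F hF => pow_wt ((hE F).2 (Or.inl hF)).1.1 (hE1 F hF) h,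
          fun F hF => pow_wt ((hE F).2 (Or.inr hF)).1.1 (hE2 F hF) h⟩
      · rintro ⟨h1, h2⟩
        refine D3 (fun G => G.Nonempty) (fun G v _ => ⟨v, mem_insert_self _ _⟩)
          (fun G hG hn hnf => h0_of_kills hmax hK G hG hn hnf) _ G le_rfl hGf hG b ?_
        intro F hF hGF
        rcases (hE F).1 ⟨hF, hGF⟩ with h | h
        · exact h1 F h
        · exact h2 F h
    rw [this]
    tauto

theorem h1'_of_kills (hmax : ∀ F ∈ Δ.faces, F.card ≤ d) (hd : 2 ≤ d) (hV : ∀ i, {i} ∈ Δ.faces)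
    (hK : ∀ i < d, ∀ v : Fin n, Hm.Kills (maxIdeal K n) (X v) i
      (ModuleCat.of _ (MvPolynomial (Fin n) K ⧸ MI K (Pow Δ m ∅)))) : H1' Δ m := by
  intro E1 E2 hE ha v
  have htf : ∀ E : Finset (Fin n) → Prop, (∀ F, E F → Δ.IsFacet F) → 
      ∀ b, ¬ (JE m E b) → ∃ v, ∀ k, ¬ (JE m E (b + Pi.single v k)) := by
    intro E hE b hb1
    simp only [JE, not_forall] at hb1
    obtain ⟨F, hF, hb1⟩ := hb1
    obtain ⟨w, hw⟩ : F.Nonempty := by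
      rw [nonempty_iff_ne_empty]
      rintro rfl
      have := (hE ∅ hF).2 {v} (hV v) (by simp)
      simp at this
    refine ⟨w, fun k h => ?_⟩
    have := h F hF
    rw [wt_add, wt_single] at this
    simp [hw] at this
    exact hb1 this
  have hX : (X v : MvPolynomial (Fin n) K) = monomial (fs (Pi.single v 1)) 1 := by
    rw [X]; congr 2; ext i; rw [Finsupp.single_eq_pi_single]; rfl
  have h1 := Hm.Kills.factor (Q' := MI K (fun b => JE m E1 b ∧ JE m E2 b)) (MI_mono fun a ha =>
      ⟨fun F hF => pow_wt ((hE F).2 (Or.inl hF)).1 (empty_subset _) ha,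
        fun F hF => pow_wt ((hE F).2 (Or.inr hF)).1 (empty_subset _) ha⟩) (y := X v) ?_ (hK 1 (by omega) v)
  · rw [hX, monomial_mul, one_mul] at h1
    have e : fs (Pi.single v 1) + fs (Pi.single v 1) = fs (Pi.single v 2 : Fin n → ℕ) := by
      ext i
      simp only [Finsupp.add_apply, fs_apply]
      by_cases hi : i = v
      · subst hi; simp
      · simp [hi]
    rw [e] at h1
    have h2 := mv_mem (Up.je _ _) (Up.je _ _) h1 (htf E1 fun F hF => (hE F).2 (Or.inl hF))
      (htf E2 fun F hF => (hE F).2 (Or.inr hF)) 0 (fun v => by simpa using ha v)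
    simpa using h2
  · intro f hf
    rw [hX, monomial_mul_mem (Up.pow _ _ _)]
    intro b hb
    have hb2 := (mem_MI ((Up.je _ _).and (Up.je _ _))).1 hf b hb
    have h3 := hK 0 (by omega) v
    rw [hX] at h3
    have := zero_mem' (Up.pow _ _ _) h3 b ?_
    · simpa [coe_fs] using this
    · intro w
      refine ⟨m, pow_lift (G := ∅) ?_⟩
      refine D3 (fun G => G.Nonempty) (fun G v _ => ⟨v, mem_insert_self _ _⟩)
          (fun G hG hn hnf => h0_of_kills hmax hK G hG hn hnf) _ (insert w ∅) le_rfl (by simpa using hV w) (by simp) b ?_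
      intro F hF _
      rcases (hE F).1 hF with h | h
      · exact hb2.1 F h
      · exact hb2.2 F h

theorem exists_max (Δ : SimComplex n) (hdim : 2 ≤ Δ.dim) : ∃ d, 3 ≤ d ∧ (∀ F ∈ Δ.faces, F.card ≤ d) ∧
    ∃ F ∈ Δ.faces, F.card = d := by
  have hb : BddAbove (Finset.card '' Δ.faces) := ⟨n, by
    rintro _ ⟨F, _, rfl⟩; simpa using card_le_univ F⟩
  have hd : 3 ≤ sSup (Finset.card '' Δ.faces) := by
    unfold SimComplex.dim at hdim
    simp only [Int.ofNat_eq_natCast] at hdim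
    omega
  have hne : (Finset.card '' Δ.faces).Nonempty := by
    by_contra h
    rw [Set.not_nonempty_iff_eq_empty] at h
    rw [h] at hd; simp at hd
  refine ⟨_, hd, fun F hF => le_csSup hb ⟨F, hF, rfl⟩, ?_⟩
  obtain ⟨F, hF, h⟩ := Nat.sSup_mem hne hb
  exact ⟨F, hF, h⟩

theorem dim_ge (F : Finset (Fin n)) (hF : F ∈ Δ.faces) (hm : m ≠ 0) :
    (F.card : WithBot ℕ∞) ≤ ringKrullDim (MvPolynomial (Fin n) K ⧸ SRIdeal K Δ ^ m) := by
  classical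
  let φ : MvPolynomial (Fin n) K →ₐ[K] MvPolynomial F K :=
    aeval (fun i => if h : i ∈ F then X ⟨i, h⟩ else 0)
  have hφ : ∀ f ∈ SRIdeal K Δ ^ m, φ.toRingHom f = 0 := by
    intro f hf
    have h1 := Ideal.pow_le_self hm hf
    have h2 : SRIdeal K Δ ≤ RingHom.ker φ.toRingHom := by
      unfold SRIdeal
      rw [Ideal.span_le]
      rintro _ ⟨A, hA, rfl⟩
      have : ¬ A ⊆ F := fun h => hA (Δ.down_closed hF h)
      obtain ⟨i, hi, hiF⟩ := not_subset.1 this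
      show φ (faceMonomial K A) = 0
      unfold faceMonomial
      rw [map_prod]
      exact prod_eq_zero hi (by simp [φ, hiF])
    exact h2 h1
  have hs : Function.Surjective (Ideal.Quotient.lift _ φ.toRingHom hφ) := by
    intro g
    refine ⟨Ideal.Quotient.mk _ (rename Subtype.val g), ?_⟩
    rw [Ideal.Quotient.lift_mk]
    show φ (rename Subtype.val g) = g
    rw [aeval_rename]
    have : (fun i => if h : i ∈ F then X ⟨i, h⟩ else 0) ∘ (Subtype.val : F → Fin n) = (X : F → MvPolynomial F K) := by
      ext1 i; simp
    rw [this, aeval_X_left_apply]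
  have := ringKrullDim_le_of_surjective _ hs
  rw [MvPolynomial.ringKrullDim_of_isNoetherianRing, ringKrullDim_eq_zero_of_field] at this
  simpa using this

theorem ci_of_kills (Δ : SimComplex n) (hV : ∀ i, {i} ∈ Δ.faces) (hdim : 2 ≤ Δ.dim) (hm : 3 ≤ m)
    (h : ∀ F ∈ Δ.faces, ∀ i < F.card, ∀ v : Fin n, Hm.Kills (maxIdeal K n) (X v) i
      (ModuleCat.of _ (MvPolynomial (Fin n) K ⧸ SRIdeal K Δ ^ m))) : Δ.IsCompleteIntersection := by
  obtain ⟨d, hd, hmax, F, hF, hFc⟩ := exists_max Δ hdim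
  have hK : ∀ i < d, ∀ v : Fin n, Hm.Kills (maxIdeal K n) (X v) i
      (ModuleCat.of _ (MvPolynomial (Fin n) K ⧸ MI K (Pow Δ m ∅))) := by
    intro i hi v
    rw [← SR_pow]
    exact h F hF i (by omega) v
  have H : Hyp Δ m d := 
    { hm := hm, hd := hd, hmax := hmax, hex := ⟨F, hF, hFc⟩
      h0 := h0_of_kills hmax hK
      h1 := h1_of_kills hmax hK
      h1' := h1'_of_kills hmax (by omega) hV hK }
  exact H.ci

theorem qb_ci (Δ : SimComplex n) (hV : ∀ i, {i} ∈ Δ.faces) (hdim : 2 ≤ Δ.dim) (hm : 3 ≤ m)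
    (h : IsQuasiBuchsbaum K (SRIdeal K Δ ^ m)) : Δ.IsCompleteIntersection := by
  refine ci_of_kills Δ hV hdim hm (K := K) fun F hF i hi v => ?_
  exact IsQuasiBuchsbaum.kills h (lt_of_lt_of_le (by exact_mod_cast hi) (dim_ge F hF (by omega))) v

end Cb

end

section

open CategoryTheory Opposite Limits

namespace Hm
variable {R : Type} [CommRing R]

/-- vanishing of Ext into a cyclic module -/
def W (N : ModuleCat.{0} R) (i : ℕ) (Q : Ideal R) : Prop := V N i (ModuleCat.of R (R ⧸ Q))

theorem W.three {N : ModuleCat.{0} R} {i : ℕ} {Q : Ideal R} {y : R} (hy : ∀ f, y * f ∈ Q → f ∈ Q)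
    (h : W N i Q) (h' : W N (i+1) Q) : W N i (Q ⊔ Ideal.span {y}) := by
  have hh : ∀ f, y * f ∈ Q ↔ f ∈ Q := fun f => ⟨hy f, fun h => Q.mul_mem_left _ h⟩
  obtain ⟨h1, h2, h3⟩ := col_ses Q Q y hh
  exact V_three (ses _ _ h1 h2 h3) N h h'

theorem W.two {N : ModuleCat.{0} R} {i : ℕ} {Q Q' : Ideal R} {y : R} (hh : ∀ f, y * f ∈ Q ↔ f ∈ Q')
    (h : W N i Q') (h' : W N i (Q ⊔ Ideal.span {y})) : W N i Q := by
  obtain ⟨h1, h2, h3⟩ := col_ses Q Q' y hh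
  exact V_two (ses _ _ h1 h2 h3) N h h'

theorem W.reg {N : ModuleCat.{0} R} {i : ℕ} {Q : Ideal R} {y : R} (hN : ∀ u : N, y • u = 0)
    (hy : ∀ f, y * f ∈ Q → f ∈ Q)
    (h : ∀ j, j + 1 = i → W N j (Q ⊔ Ideal.span {y})) : W N i Q := by
  have hh : ∀ f, y * f ∈ Q ↔ f ∈ Q := fun f => ⟨hy f, fun h => Q.mul_mem_left _ h⟩
  obtain ⟨h1, h2, h3⟩ := col_ses Q Q y hh
  have e : ModuleCat.ofHom (colF Q Q y hh) = y • 𝟙 (ModuleCat.of R (R ⧸ Q)) := by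
    ext : 1
    refine LinearMap.ext fun a => ?_
    obtain ⟨f, rfl⟩ := Submodule.Quotient.mk_surjective _ a
    rfl
  have hs := ses _ _ h1 h2 h3
  have hw := ses_w _ _ h2
  rw [e] at hw
  refine V_rees N y hN _ _ (ModuleCat.ofHom (colG Q y)) hw ?_ h
  convert hs using 2
  exact e.symm

theorem W.top (N : ModuleCat.{0} R) (i : ℕ) : W N i (⊤ : Ideal R) := by
  intro z _
  refine ⟨0, 0, ?_⟩
  ext x
  have : ∀ a b : (R ⧸ (⊤ : Ideal R)), a = b := fun a b => by
    obtain ⟨a, rfl⟩ := Submodule.Quotient.mk_surjective _ a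
    obtain ⟨b, rfl⟩ := Submodule.Quotient.mk_surjective _ b
    rw [Submodule.Quotient.eq]; trivial
  exact this _ _

theorem W.hom {J Q : Ideal R} (h : W (ModuleCat.of R (R ⧸ J)) 0 Q) {f : R} (hf : ∀ y ∈ J, y * f ∈ Q) : f ∈ Q := by
  have hu : ∀ y ∈ J, y • (Submodule.Quotient.mk f : R ⧸ Q) = 0 := by
    intro y hy
    rw [← Submodule.Quotient.mk_smul, Submodule.Quotient.mk_eq_zero]
    exact hf y hy
  let g : ModuleCat.of R (R ⧸ J) ⟶ ModuleCat.of R (R ⧸ Q) := ModuleCat.ofHom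
    (Submodule.liftQ _ (LinearMap.toSpanSingleton R (R ⧸ Q) (Submodule.Quotient.mk f)) (fun y hy => hu y hy))
  let P := projectiveResolution (ModuleCat.of R (R ⧸ J))
  have h0 := (h (aug P ≫ g) (IsCyc.of (by
    rw [← Category.assoc]
    have := d_aug P
    rw [this]; exact zero_comp))).zero
  obtain ⟨p, hp⟩ := aug_surj P (Submodule.Quotient.mk (1:R) : R ⧸ J)
  have h3 := congrArg (fun f => f.hom p) h0
  have h4 : g.hom (aug P p) = 0 := h3
  rw [hp] at h4
  have h6 : g.hom (Submodule.Quotient.mk (1:R) : R ⧸ J) = (1:R) • (Submodule.Quotient.mk f : R ⧸ Q) := rfl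
  rw [h6, one_smul] at h4
  exact (Submodule.Quotient.mk_eq_zero _).1 h4

theorem Kills.of_V {J : Ideal R} {x : R} {i : ℕ} {M : ModuleCat.{0} R}
    (h : ∀ k, V (ModuleCat.of R (R ⧸ J ^ k)) i M) : Kills J x i M := by
  intro k z hz
  refine ⟨k, le_rfl, ProjectiveResolution.lift (tr J le_rfl) _ _,
    lift_aug _ _ _, ?_⟩
  exact ((h k z hz).smul x).pre _

theorem W.bot {N : ModuleCat.{0} R} {i : ℕ} (h : W N i (⊥ : Ideal R)) : V N i (ModuleCat.of R R) := by
  intro z hz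
  let e : (R ⧸ (⊥ : Ideal R)) ≃ₗ[R] R := Submodule.quotEquivOfEqBot ⊥ rfl
  have h1 := h (z ≫ ModuleCat.ofHom e.symm.toLinearMap) (fun j => by rw [← Category.assoc, hz j, zero_comp])
  have h2 := h1.comp (ModuleCat.ofHom e.toLinearMap)
  have : (z ≫ ModuleCat.ofHom e.symm.toLinearMap) ≫ ModuleCat.ofHom e.toLinearMap = z := by
    rw [Category.assoc, ← ModuleCat.ofHom_comp]
    have : e.toLinearMap ∘ₗ e.symm.toLinearMap = LinearMap.id := by ext; simp
    rw [this]; exact Category.comp_id _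
  rwa [this] at h2

theorem W.of_bot {N : ModuleCat.{0} R} {i : ℕ} (h : V N i (ModuleCat.of R R)) : W N i (⊥ : Ideal R) := by
  intro z hz
  let e : (R ⧸ (⊥ : Ideal R)) ≃ₗ[R] R := Submodule.quotEquivOfEqBot ⊥ rfl
  have h1 := h (z ≫ ModuleCat.ofHom e.toLinearMap) (fun j => by rw [← Category.assoc, hz j, zero_comp])
  have h2 := h1.comp (ModuleCat.ofHom e.symm.toLinearMap)
  have : (z ≫ ModuleCat.ofHom e.toLinearMap) ≫ ModuleCat.ofHom e.symm.toLinearMap = z := by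
    rw [Category.assoc, ← ModuleCat.ofHom_comp]
    have : e.symm.toLinearMap ∘ₗ e.toLinearMap = LinearMap.id := by ext; simp
    rw [this]; exact Category.comp_id _
  rwa [this] at h2

/-- prime avoidance: a regular element in a prime -/
theorem exists_regular [IsNoetherianRing R] (P Q : Ideal R) [hP : P.IsMaximal]
    (h : ∀ f, (∀ y ∈ P, y * f ∈ Q) → f ∈ Q) : ∃ x ∈ P, ∀ f, x * f ∈ Q → f ∈ Q := by
  by_contra! hcon
  have hsub : (P : Set R) ⊆ ⋃ p ∈ associatedPrimes R (R ⧸ Q), p := by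
    intro x hx
    obtain ⟨f, hf, hfQ⟩ := hcon x hx
    rw [biUnion_associatedPrimes_eq_zero_divisors]
    refine ⟨Submodule.Quotient.mk f, ?_, ?_⟩
    · rwa [Ne, Submodule.Quotient.mk_eq_zero]
    · rw [← Submodule.Quotient.mk_smul, Submodule.Quotient.mk_eq_zero]; exact hf
  obtain ⟨p, hp, hle⟩ := (P.subset_union_prime_finite (associatedPrimes.finite R (R ⧸ Q)) (f := id) 0 0 fun _ h _ _ ↦ h.1).1 hsub
  have hpp : p.IsPrime := hp.1
  have : P = p := hP.eq_of_le hpp.ne_top hle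
  subst this
  obtain ⟨_, u, hu⟩ := isAssociatedPrime_iff.1 hp
  obtain ⟨f, rfl⟩ := Submodule.Quotient.mk_surjective _ u
  have hm : ∀ y, y ∈ P ↔ y * f ∈ Q := by
    intro y
    rw [hu, Submodule.mem_colon_singleton, ← Submodule.Quotient.mk_smul, Submodule.mem_bot,
      Submodule.Quotient.mk_eq_zero]
    rfl
  have h1 : f ∈ Q := h f fun y hy => (hm y).1 hy
  exact hpp.ne_top ((Ideal.eq_top_iff_one _).2 ((hm 1).2 (by simpa using h1)))

/-- regular sequences -/
def D (P : Ideal R) : ℕ → Ideal R → Prop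
  | 0, _ => True
  | r+1, Q => ∃ x ∈ P, (∀ f, x * f ∈ Q → f ∈ Q) ∧ D P r (Q ⊔ Ideal.span {x})

theorem D.W {P : Ideal R} {N : ModuleCat.{0} R} (hN : ∀ x ∈ P, ∃ k : ℕ, ∀ u : N, x ^ k • u = 0) {r : ℕ} :
    ∀ {Q : Ideal R}, D P r Q → ∀ i < r, W N i Q := by
  induction r with
  | zero => intro Q _ i hi; omega
  | succ r ih =>
    rintro Q ⟨x, hx, hreg, hD⟩ i hi
    have h1 := ih hD
    have hp : ∀ t f, x ^ t * f ∈ Q → f ∈ Q := by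
      intro t
      induction t with
      | zero => simp
      | succ t iht =>
        intro f hf
        rw [pow_succ, mul_assoc] at hf
        exact hreg _ (iht _ hf)
    have h2 : ∀ t : ℕ, ∀ i < r, Hm.W N i (Q ⊔ Ideal.span {x ^ t}) := by
      intro t
      induction t with
      | zero =>
        intro i _
        have : Q ⊔ Ideal.span {x ^ 0} = ⊤ := by simp
        rw [this]
        exact W.top N i
      | succ t iht =>
        intro i hi
        refine W.two (Q' := Q ⊔ Ideal.span {x ^ t}) (y := x) ?_ (iht i hi) ?_
        · intro f
          simp only [Submodule.mem_sup, Ideal.mem_span_singleton']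
          constructor
          · rintro ⟨q, hq, _, ⟨c, rfl⟩, h⟩
            refine ⟨f - c * x ^ t, hreg _ ?_, _, ⟨c, rfl⟩, by ring⟩
            have : x * (f - c * x ^ t) = q := by rw [mul_sub, ← h]; ring
            rwa [this]
          · rintro ⟨q, hq, _, ⟨c, rfl⟩, h⟩
            exact ⟨x * q, Q.mul_mem_left _ hq, _, ⟨c, rfl⟩, by rw [← h]; ring⟩
        · have : Q ⊔ Ideal.span {x ^ (t+1)} ⊔ Ideal.span {x} = Q ⊔ Ideal.span {x} := by
            rw [sup_assoc]
            congr 1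
            rw [sup_eq_right, Ideal.span_singleton_le_span_singleton]
            exact dvd_pow_self x (Nat.succ_ne_zero t)
          rw [this]
          exact h1 i hi
    obtain ⟨k, hk⟩ := hN x hx
    exact W.reg hk (hp k) fun j hj => h2 k j (by omega)

theorem D.W_one {P : Ideal R} {r : ℕ} {Q : Ideal R} (h : D P r Q) : ∀ i < r, Hm.W (ModuleCat.of R (R ⧸ P)) i Q := by
  refine h.W fun x hx => ⟨1, fun u => ?_⟩
  obtain ⟨u, rfl⟩ := Submodule.Quotient.mk_surjective _ u
  rw [← Submodule.Quotient.mk_smul, Submodule.Quotient.mk_eq_zero, pow_one]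
  exact P.mul_mem_right _ hx

theorem D.W_pow {P : Ideal R} {r : ℕ} {Q : Ideal R} (h : D P r Q) (k : ℕ) :
    ∀ i < r, Hm.W (ModuleCat.of R (R ⧸ P ^ k)) i Q := by
  refine h.W fun x hx => ⟨k, fun u => ?_⟩
  obtain ⟨u, rfl⟩ := Submodule.Quotient.mk_surjective _ u
  rw [← Submodule.Quotient.mk_smul, Submodule.Quotient.mk_eq_zero]
  exact Ideal.mul_mem_right _ _ (Ideal.pow_mem_pow hx k)

theorem D.of_W [IsNoetherianRing R] (P : Ideal R) [hP : P.IsMaximal] {r : ℕ} :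
    ∀ {Q : Ideal R}, (∀ i < r, Hm.W (ModuleCat.of R (R ⧸ P)) i Q) → D P r Q := by
  induction r with
  | zero => intro _ _; trivial
  | succ r ih =>
    intro Q h
    obtain ⟨x, hx, hreg⟩ := exists_regular P Q fun f hf => (h 0 (by omega)).hom hf
    exact ⟨x, hx, hreg, ih fun i hi => W.three hreg (h i (by omega)) (h (i+1) (by omega))⟩

theorem D.map {B : Type} [CommRing B] (φ : R →+* B) (hφ : Function.Surjective φ) {P : Ideal R} {r : ℕ} :
    ∀ {Q : Ideal R}, RingHom.ker φ ≤ Q → D P r Q → D (P.map φ) r (Q.map φ) := by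
  induction r with
  | zero => intro _ _ _; trivial
  | succ r ih =>
    rintro Q hQ ⟨x, hx, hreg, hD⟩
    refine ⟨φ x, Ideal.mem_map_of_mem _ hx, fun b hb => ?_, ?_⟩
    · obtain ⟨f, rfl⟩ := hφ b
      rw [← map_mul, ← Ideal.mem_comap, Ideal.comap_map_of_surjective' _ hφ, sup_eq_left.2 hQ] at hb
      exact Ideal.mem_map_of_mem _ (hreg f hb)
    · have := ih (hQ.trans le_sup_left) hD
      rwa [Ideal.map_sup, Ideal.map_span, Set.image_singleton] at this

theorem D.of_loc [IsNoetherianRing R] (P I : Ideal R) [hP : P.IsMaximal] {B : Type} [CommRing B] (g : R →+* B)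
    (hg : ∀ b, ∃ u f, IsUnit u ∧ b * u = g f)
    (hmem : ∀ Q, I ≤ Q → ∀ f, g f ∈ Ideal.map g Q ↔ ∃ t ∉ P, t * f ∈ Q) {r : ℕ} :
    ∀ {Q : Ideal R}, I ≤ Q → (∀ i < r, Hm.W (ModuleCat.of B (B ⧸ P.map g)) i (Q.map g)) → D P r Q := by
  induction r with
  | zero => intro _ _ _; trivial
  | succ r ih =>
    intro Q hI h
    obtain ⟨x, hx, hreg⟩ := exists_regular P Q fun f hf => by
      have h1 : g f ∈ Q.map g := (h 0 (by omega)).hom fun y hy => by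
        refine Submodule.span_induction ?_ ?_ ?_ ?_ hy
        · rintro _ ⟨y, hy, rfl⟩
          rw [← map_mul]
          exact Ideal.mem_map_of_mem _ (hf y hy)
        · simp
        · intro a b _ _ ha hb
          rw [add_mul]; exact add_mem ha hb
        · intro a b _ hb
          rw [smul_eq_mul, mul_assoc]; exact Ideal.mul_mem_left _ _ hb
      obtain ⟨t, ht, htf⟩ := (hmem Q hI f).1 h1
      obtain ⟨a, p, hp, e⟩ := hP.exists_inv ht
      have : f = a * (t * f) + p * f := by
        rw [← mul_assoc, ← add_mul, e, one_mul]
      rw [this]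
      exact add_mem (Q.mul_mem_left _ htf) (hf p hp)
    have hreg' : ∀ b, g x * b ∈ Q.map g → b ∈ Q.map g := by
      intro b hb
      obtain ⟨u, f, hu, e⟩ := hg b
      have h2 : g (x * f) ∈ Q.map g := by
        rw [map_mul, ← e, ← mul_assoc]; exact Ideal.mul_mem_right _ _ hb
      obtain ⟨t, ht, htf⟩ := (hmem Q hI _).1 h2
      have h3 : g f ∈ Q.map g := (hmem Q hI f).2 ⟨t, ht, hreg _ (by rwa [← mul_assoc, mul_comm x t, mul_assoc])⟩
      rw [← e] at h3
      exact (Ideal.mul_unit_mem_iff_mem _ hu).1 h3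
    refine ⟨x, hx, hreg, ih (hI.trans le_sup_left) fun i hi => ?_⟩
    rw [Ideal.map_sup, Ideal.map_span, Set.image_singleton]
    exact W.three hreg' (h i (by omega)) (h (i+1) (by omega))

end Hm

end

section

open CategoryTheory Opposite Limits

namespace Hm
variable {R : Type} [CommRing R]

open IsLocalRing in
theorem reg_aux [IsLocalRing R] [IsNoetherianRing R] (r : ℕ) : ∀ Y X : Finset R,
    ((Y.card + r : ℕ) : ℕ∞) ≤ (maximalIdeal R).height → X.card ≤ r →
    Ideal.span (Y : Set R) ⊔ Ideal.span (X : Set R) = maximalIdeal R →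
    (Ideal.span (Y : Set R)).IsPrime ∧ D (maximalIdeal R) r (Ideal.span (Y : Set R)) := by
  classical
  induction r with
  | zero =>
    intro Y X _ hX hsp
    have : X = ∅ := by simpa using hX
    subst this
    simp at hsp
    rw [hsp]
    exact ⟨inferInstance, trivial⟩
  | succ r ih =>
    intro Y X hY hX hsp
    set J := Ideal.span (Y : Set R) with hJ
    set m := maximalIdeal R with hm
    have hmin : m ∉ J.minimalPrimes := by
      intro h
      have h1 := Ideal.height_le_card_of_mem_minimalPrimes_span_finset h
      have h2 := hY.trans h1
      have : Y.card + (r + 1) ≤ Y.card := by exact_mod_cast h2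
      omega
    have hJm : J ≤ m := by rw [← hsp]; exact le_sup_left
    have hsq : ¬ m ≤ J ⊔ m • m := by
      intro h
      have h1 := Submodule.le_of_le_smul_of_le_jacobson_bot (IsNoetherian.noetherian m)
        (IsLocalRing.maximalIdeal_le_jacobson ⊥) h
      have h2 : m = J := le_antisymm h1 hJm
      apply hmin
      rw [← h2, Ideal.minimalPrimes_eq_subsingleton_self]
      rfl
    obtain ⟨x, hxm, hx2, hxQ⟩ : ∃ x ∈ m, x ∉ J ⊔ m • m ∧ ∀ Q ∈ J.minimalPrimes, x ∉ Q := by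
      by_contra! hcon
      have hsub : (m : Set R) ⊆ ⋃ p ∈ insert (J ⊔ m • m) J.minimalPrimes, (id p : Ideal R) := by
        intro x hx
        by_cases h : x ∈ J ⊔ m • m
        · exact Set.mem_biUnion (Set.mem_insert _ _) h
        · obtain ⟨Q, hQ, hxQ⟩ := hcon x hx h
          exact Set.mem_biUnion (Set.mem_insert_of_mem _ hQ) hxQ
      obtain ⟨p, hp, hle⟩ := (Ideal.subset_union_prime_finite
        ((Ideal.finite_minimalPrimes_of_isNoetherianRing R J).insert _) (J ⊔ m • m) (J ⊔ m • m)
        (by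
          rintro p (rfl | hp) h1 _
          · exact absurd rfl h1
          · exact hp.1.1)).1 hsub
      rcases hp with rfl | hp
      · exact hsq hle
      · have := hp.1.1
        have h1 : m = p := (maximalIdeal.isMaximal R).eq_of_le this.ne_top hle
        exact hmin (h1 ▸ hp)
    -- exchange
    obtain ⟨j, hj, y, hy, hjy⟩ := Submodule.mem_sup.1 (hsp ▸ hxm)
    obtain ⟨a, ha⟩ := Submodule.mem_span_finset.1 hy
    obtain ⟨i0, hi0, hu⟩ : ∃ i ∈ X, a i ∉ m := by
      by_contra! hcon
      apply hx2
      rw [← hjy]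
      refine Submodule.add_mem_sup hj ?_
      rw [← ha.2]
      refine sum_mem fun i hi => ?_
      refine Submodule.smul_mem_smul (hcon i hi) ?_
      rw [← hsp]
      exact Ideal.mem_sup_right (Ideal.subset_span hi)
    have hun : IsUnit (a i0) := by simpa [hm] using hu
    obtain ⟨u, hu⟩ := hun
    have hins : Ideal.span ((insert x Y : Finset R) : Set R) = J ⊔ Ideal.span {x} := by
      rw [Finset.coe_insert, Ideal.span_insert, sup_comm]
    have hspan : Ideal.span ((insert x Y : Finset R) : Set R) ⊔ Ideal.span ((X.erase i0 : Finset R) : Set R) = m := by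
      rw [hins]
      apply le_antisymm
      · refine sup_le (sup_le hJm ((Ideal.span_singleton_le_iff_mem _).2 hxm)) ?_
        rw [← hsp]
        refine le_trans (Ideal.span_mono ?_) le_sup_right
        simp
      · set T := J ⊔ Ideal.span {x} ⊔ Ideal.span ((X.erase i0 : Finset R) : Set R) with hT
        have hJT : J ≤ T := le_sup_left.trans le_sup_left
        have hXT : ∀ i ∈ X.erase i0, i ∈ T := fun i hi => Ideal.mem_sup_right (Ideal.subset_span hi)
        have hxT : x ∈ T := Ideal.mem_sup_left (Ideal.mem_sup_right (Ideal.mem_span_singleton_self x))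
        have hi0T : i0 ∈ T := by
          have h1 : a i0 * i0 = x - j - ∑ i ∈ X.erase i0, a i • i := by
            rw [← hjy, ← ha.2, ← Finset.add_sum_erase X _ hi0]
            simp
          have h2 : a i0 * i0 ∈ T := by
            rw [h1]
            exact sub_mem (sub_mem hxT (hJT hj)) (sum_mem fun i hi => T.mul_mem_left _ (hXT i hi))
          rw [← hu] at h2
          exact (Ideal.unit_mul_mem_iff_mem _ u.isUnit).1 h2
        rw [← hsp]
        refine sup_le hJT (Ideal.span_le.2 fun i hi => ?_)
        by_cases h : i = i0
        · rw [h]; exact hi0T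
        · exact hXT i (Finset.mem_erase.2 ⟨h, hi⟩)
    obtain ⟨hpr, hD⟩ := ih (insert x Y) (X.erase i0) (le_trans (by
      have := Finset.card_insert_le x Y
      exact_mod_cast (by omega : (insert x Y).card + r ≤ Y.card + (r + 1))) hY) (by
        rw [Finset.card_erase_of_mem hi0]; omega) hspan
    rw [hins] at hpr hD
    obtain ⟨Q, hQ, hQle⟩ := Ideal.exists_minimalPrimes_le (I := J) (J := J ⊔ Ideal.span {x}) le_sup_left
    have hQp : Q.IsPrime := hQ.1.1
    have hQJ : Q ≤ J := by
      refine Submodule.le_of_le_smul_of_le_jacobson_bot (I := m) (IsNoetherian.noetherian Q)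
        (IsLocalRing.maximalIdeal_le_jacobson ⊥) ?_
      intro q hq
      obtain ⟨j, hj, z, hz, rfl⟩ := Submodule.mem_sup.1 (hQle hq)
      obtain ⟨c, rfl⟩ := Ideal.mem_span_singleton'.1 hz
      have h1 : c * x ∈ Q := by
        have := sub_mem hq (hQ.1.2 hj)
        rwa [add_sub_cancel_left] at this
      have h2 : c ∈ Q := (hQp.mem_or_mem h1).resolve_right (hxQ Q hQ)
      refine Submodule.add_mem_sup hj ?_
      rw [mul_comm]
      exact Submodule.smul_mem_smul hxm h2
    have hQe : Q = J := le_antisymm hQJ hQ.1.2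
    have hJp : J.IsPrime := hQe ▸ hQp
    refine ⟨hJp, x, hxm, fun f hf => ?_, hD⟩
    exact (hJp.mem_or_mem hf).resolve_left (hQe ▸ hxQ Q hQ)

open IsLocalRing in
theorem D.of_regular [IsRegularLocalRing R] :
    ∃ r : ℕ, (r : WithBot ℕ∞) = ringKrullDim R ∧ D (maximalIdeal R) r ⊥ := by
  classical
  have hfg : (maximalIdeal R).FG := IsNoetherian.noetherian _
  have h1 := (isRegularLocalRing_iff R).1 inferInstance
  refine ⟨_, h1, ?_⟩
  have hfin : (Submodule.generators (maximalIdeal R)).Finite := Submodule.FG.finite_generators hfg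
  have h2 := reg_aux (R := R) (maximalIdeal R).spanFinrank ∅ hfin.toFinset (by
    rw [← maximalIdeal_height_eq_ringKrullDim] at h1
    have : (((maximalIdeal R).spanFinrank : ℕ) : ℕ∞) = (maximalIdeal R).height := by exact_mod_cast h1
    simp [this]) (by
    rw [← Set.ncard_eq_toFinset_card _ hfin]
    exact (Submodule.FG.generators_ncard hfg).le) (by
    rw [Set.Finite.coe_toFinset]
    simp only [Finset.coe_empty, Ideal.span_empty, bot_sup_eq]
    exact Submodule.span_generators _)
  simpa using h2.2

end Hm

end

section

open CategoryTheory Opposite Limits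

namespace Hm
variable {R : Type} [CommRing R] {ι : Type} [DecidableEq ι]

/-- ideal generated by part of a family -/
def J (f : ι → R) (T : Finset ι) : Ideal R := Ideal.span (f '' (T : Set ι))

theorem J_insert (f : ι → R) (A : ι) (T : Finset ι) : J f (insert A T) = J f T ⊔ Ideal.span {f A} := by
  unfold J
  rw [Finset.coe_insert, Set.image_insert_eq, Ideal.span_insert, sup_comm]

theorem J_empty (f : ι → R) : J f ∅ = ⊥ := by simp [J]

theorem J_map {B : Type} [CommRing B] (g : R →+* B) (f : ι → R) (T : Finset ι) (k : ℕ) :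
    (J f T ^ k).map g = J (fun i => g (f i)) T ^ k := by
  rw [Ideal.map_pow]
  unfold J
  rw [Ideal.map_span, ← Set.image_comp]
  rfl

/-- regularity of the powers -/
def Good (T0 : Finset ι) (f : ι → R) : Prop :=
  ∀ T ⊆ T0, ∀ A ∈ T0, ∀ (k : ℕ) (g : R),
    (A ∈ T → f A * g ∈ J f T ^ (k+1) → g ∈ J f T ^ k) ∧ (A ∉ T → f A * g ∈ J f T ^ k → g ∈ J f T ^ k)

theorem pow_sup_span (I : Ideal R) (x : R) (k : ℕ) :
    (I ⊔ Ideal.span {x}) ^ (k+1) ⊔ Ideal.span {x} = I ^ (k+1) ⊔ Ideal.span {x} := by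
  apply le_antisymm
  · refine sup_le ?_ le_sup_right
    induction k with
    | zero => simp
    | succ k ih =>
      rw [pow_succ, pow_succ I]
      refine (Ideal.mul_mono_left ih).trans ?_
      have h1 : I ^ (k+1) * Ideal.span {x} ≤ Ideal.span {x} := Ideal.mul_le_right
      have h2 : Ideal.span {x} * (I ⊔ Ideal.span {x}) ≤ Ideal.span {x} := Ideal.mul_le_left
      rw [Ideal.sup_mul, Ideal.mul_sup]
      exact sup_le (sup_le le_sup_left (le_trans h1 le_sup_right)) (le_trans h2 le_sup_right)
  · exact sup_le_sup_right (Ideal.pow_right_mono le_sup_left _) _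

theorem Good.W {T0 : Finset ι} {f : ι → R} (H : Good T0 f) {N : ModuleCat.{0} R} {h : ℕ}
    (hN : ∀ i < h, Hm.W N i ⊥) (T : Finset ι) : T ⊆ T0 → ∀ k i, i + T.card < h → Hm.W N i (J f T ^ k) := by
  induction T using Finset.induction_on with
  | empty =>
    intro _ k i hi
    cases k with
    | zero => rw [pow_zero, Ideal.one_eq_top]; exact W.top _ _
    | succ k =>
      rw [J_empty, ← Ideal.zero_eq_bot, zero_pow (by omega)]
      exact hN i (by simpa using hi)
  | insert A T hA ih =>
    intro hT k
    rw [Finset.insert_subset_iff] at hT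
    rw [Finset.card_insert_of_notMem hA]
    have hT' : insert A T ⊆ T0 := Finset.insert_subset_iff.2 hT
    induction k with
    | zero => intro i _; rw [pow_zero, Ideal.one_eq_top]; exact W.top _ _
    | succ k ihk =>
      intro i hi
      refine W.two (y := f A) (Q' := J f (insert A T) ^ k) ?_ (ihk i hi) ?_
      · intro g
        refine ⟨(H _ hT' A hT.1 k g).1 (Finset.mem_insert_self _ _), fun hg => ?_⟩
        rw [pow_succ']
        exact Ideal.mul_mem_mul (Ideal.subset_span ⟨A, by simp, rfl⟩) hg
      · rw [J_insert, pow_sup_span]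
        exact W.three (fun g hg => (H T hT.2 A hT.1 _ g).2 hA hg) (ih hT.2 _ _ (by omega)) (ih hT.2 _ _ (by omega))

theorem Good.dim {T0 : Finset ι} {f : ι → R} (H : Good T0 f) (T : Finset ι) :
    T ⊆ T0 → ringKrullDim (R ⧸ J f T) + T.card ≤ ringKrullDim R := by
  induction T using Finset.induction_on with
  | empty =>
    intro _
    simpa using ringKrullDim_quotient_le _
  | insert A T hA ih =>
    intro hT
    rw [Finset.insert_subset_iff] at hT
    rw [Finset.card_insert_of_notMem hA]
    have hle : J f T ≤ J f (insert A T) := by rw [J_insert]; exact le_sup_left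
    have h1 := ringKrullDim_succ_le_of_surjective (Ideal.Quotient.factor hle) (Ideal.Quotient.factor_surjective hle)
      (r := Ideal.Quotient.mk _ (f A)) (by
        rw [mem_nonZeroDivisors_iff_right]
        intro x hx
        obtain ⟨x, rfl⟩ := Ideal.Quotient.mk_surjective x
        rw [← map_mul, Ideal.Quotient.eq_zero_iff_mem, mul_comm] at hx
        rw [Ideal.Quotient.eq_zero_iff_mem]
        simpa using (H T hT.2 A hT.1 1 x).2 hA (by simpa using hx)) (by
        rw [Ideal.Quotient.factor_mk, Ideal.Quotient.eq_zero_iff_mem]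
        exact Ideal.subset_span ⟨A, by simp, rfl⟩)
    refine le_trans ?_ (ih hT.2)
    refine le_trans ?_ (add_le_add_left h1 _)
    push_cast
    rw [add_assoc, add_comm 1]

theorem dim_pow (I : Ideal R) (m : ℕ) (hm : m ≠ 0) : ringKrullDim (R ⧸ I ^ m) = ringKrullDim (R ⧸ I) := by
  rw [ringKrullDim_quotient, ringKrullDim_quotient, PrimeSpectrum.zeroLocus_pow _ hm]

theorem Good.loc {T0 : Finset ι} {f : ι → R} (H : Good T0 f) (M : Submonoid R) (B : Type) [CommRing B] [Algebra R B]
    [IsLocalization M B] : Good T0 (fun i => algebraMap R B (f i)) := by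
  intro T hT A hA k g
  obtain ⟨⟨a, s⟩, rfl⟩ := IsLocalization.mk'_surjective M g
  simp only [← J_map (algebraMap R B)]
  have e : algebraMap R B (f A) * IsLocalization.mk' B a s = IsLocalization.mk' B (f A * a) s := by
    rw [IsLocalization.mul_mk'_eq_mk'_of_mul]
  rw [e]
  simp only [IsLocalization.mk'_mem_map_algebraMap_iff M]
  constructor
  · rintro hAT ⟨t, ht, h⟩
    exact ⟨t, ht, (H T hT A hA k _).1 hAT (by rwa [mul_left_comm])⟩
  · rintro hAT ⟨t, ht, h⟩
    exact ⟨t, ht, (H T hT A hA k _).2 hAT (by rwa [mul_left_comm])⟩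

end Hm

end

section

open Finset

namespace Cb
open MvPolynomial
variable {n : ℕ} {K : Type} [Field K] {Δ : SimComplex n} {m : ℕ}

theorem PF_prime (E : Finset (Fin n)) : (PF K E).IsPrime := by
  classical
  let ψ : MvPolynomial (Fin n) K →ₐ[K] MvPolynomial (Fin n) K :=
    aeval (fun i => if i ∈ E then 0 else X i)
  have : PF K E = RingHom.ker ψ.toRingHom := by
    apply le_antisymm
    · unfold PF
      rw [Ideal.span_le]
      rintro _ ⟨i, hi, rfl⟩
      show ψ (X i) = 0
      simp only [SetLike.mem_coe] at hi
      simp [ψ, hi]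
    · intro f hf
      have h1 : (Ideal.Quotient.mkₐ K (PF K E)).comp ψ = Ideal.Quotient.mkₐ K (PF K E) := by
        apply MvPolynomial.algHom_ext
        intro i
        by_cases hi : i ∈ E
        · have : (X i : MvPolynomial (Fin n) K) ∈ PF K E := Ideal.subset_span ⟨i, hi, rfl⟩
          have := Ideal.Quotient.eq_zero_iff_mem.2 this
          simp [ψ, hi, this]
        · simp [ψ, hi]
      have h2 := DFunLike.congr_fun h1 f
      have h3 : ψ f = 0 := hf
      rw [AlgHom.comp_apply, h3, map_zero] at h2
      exact Ideal.Quotient.eq_zero_iff_mem.1 h2.symm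
  rw [this]
  exact RingHom.ker_isPrime _

theorem PF_lt {E : Finset (Fin n)} {i : Fin n} (hi : i ∉ E) : X i ∉ PF K E := by
  unfold PF
  rw [mem_ideal_span_X_image]
  intro h
  obtain ⟨j, hj, hne⟩ := h (Finsupp.single i 1) (by simp [X])
  have : i = j := by
    by_contra hij
    simp [hij] at hne
  exact hi (this ▸ hj)

theorem SR_le_PF {F : Finset (Fin n)} (hF : F ∈ Δ.faces) : SRIdeal K Δ ≤ PF K Fᶜ := by
  unfold SRIdeal
  rw [Ideal.span_le]
  rintro _ ⟨A, hA, rfl⟩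
  have : ¬ A ⊆ F := fun h => hA (Δ.down_closed hF h)
  obtain ⟨i, hi, hiF⟩ := not_subset.1 this
  unfold faceMonomial
  rw [SetLike.mem_coe, ← Finset.mul_prod_erase _ _ hi]
  exact Ideal.mul_mem_right _ _ (Ideal.subset_span ⟨i, by simpa using hiF, rfl⟩)

theorem PF_mono {E E' : Finset (Fin n)} (h : E ⊆ E') : PF K E ≤ PF K E' :=
  Ideal.span_mono (Set.image_mono (by exact_mod_cast h))

theorem PF_univ : PF K (univ : Finset (Fin n)) = maxIdeal K n := by
  unfold PF maxIdeal
  simp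

instance max_maximal : (maxIdeal K n).IsMaximal := by
  have : maxIdeal K n = RingHom.ker (constantCoeff (R := K) (σ := Fin n)) := by
    apply le_antisymm
    · unfold maxIdeal
      rw [Ideal.span_le]
      rintro _ ⟨i, rfl⟩
      show constantCoeff (X i) = 0
      simp
    · intro f hf
      have h0 : coeff 0 f = 0 := hf
      rw [← PF_univ]
      unfold PF
      rw [mem_ideal_span_X_image]
      intro a ha
      have : a ≠ 0 := by
        rintro rfl
        exact (mem_support_iff.1 ha) h0
      obtain ⟨i, hi⟩ := Finsupp.ne_iff.1 this
      exact ⟨i, by simp, hi⟩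
  rw [this]
  exact RingHom.ker_isMaximal_of_surjective _ (fun c => ⟨C c, by simp⟩)

theorem height_ge {I : Ideal (MvPolynomial (Fin n) K)} {E : Finset (Fin n)} (hI : I ≤ PF K E) (G : Finset (Fin n)) :
    Disjoint G E → (G.card : ℕ∞) ≤ ((PF K (G ∪ E)).map (Ideal.Quotient.mk I)).height := by
  classical
  have hpr : ∀ G, ((PF K (G ∪ E)).map (Ideal.Quotient.mk I)).IsPrime := fun G => by
    have := PF_prime (K := K) (G ∪ E)
    refine Ideal.map_isPrime_of_surjective Ideal.Quotient.mk_surjective ?_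
    rw [Ideal.mk_ker]
    exact hI.trans (PF_mono subset_union_right)
  induction G using Finset.induction_on with
  | empty => intro _; simp
  | insert i G hi ih =>
    intro hd
    rw [disjoint_insert_left] at hd
    have h1 := ih hd.2
    have := hpr G
    have := hpr (insert i G)
    have hlt : (PF K (G ∪ E)).map (Ideal.Quotient.mk I) < (PF K (insert i G ∪ E)).map (Ideal.Quotient.mk I) := by
      refine lt_of_le_of_ne (Ideal.map_mono (PF_mono (union_subset_union (subset_insert _ _) subset_rfl))) fun h => ?_
      have h2 : (Ideal.Quotient.mk I) (X i) ∈ (PF K (insert i G ∪ E)).map (Ideal.Quotient.mk I) :=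
        Ideal.mem_map_of_mem _ (Ideal.subset_span ⟨i, by simp, rfl⟩)
      rw [← h, ← Ideal.mem_comap, Ideal.comap_map_of_surjective' _ Ideal.Quotient.mk_surjective, Ideal.mk_ker,
        sup_eq_left.2 (hI.trans (PF_mono subset_union_right))] at h2
      exact PF_lt (by simp [hi, hd.1]) h2
    have h3 := Ideal.height_add_one_le_of_lt_of_isPrime hlt
    rw [card_insert_of_notMem hi]
    push_cast
    exact (add_le_add_left h1 1).trans h3

theorem cm_ci (Δ : SimComplex n) (hV : ∀ i, {i} ∈ Δ.faces) (hdim : 2 ≤ Δ.dim) (hm : 3 ≤ m)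
    (h : IsCohenMacaulayIdeal (SRIdeal K Δ ^ m)) : Δ.IsCompleteIntersection := by
  classical
  refine ci_of_kills Δ hV hdim hm (K := K) fun F hF i hi v => ?_
  apply Hm.Kills.of_V
  intro k
  set I := SRIdeal K Δ ^ m with hI
  have hIF : I ≤ PF K Fᶜ := (Ideal.pow_le_self (by omega)).trans (SR_le_PF hF)
  have hIP : I ≤ maxIdeal K n := hIF.trans (by rw [← PF_univ]; exact PF_mono (subset_univ _))
  let q := Ideal.Quotient.mk I
  let P' := (maxIdeal K n).map q
  have hP' : P'.IsPrime := by
    refine Ideal.map_isPrime_of_surjective Ideal.Quotient.mk_surjective ?_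
    rw [Ideal.mk_ker]
    exact hIP
  have hc : ∀ f, q f ∈ P' ↔ f ∈ maxIdeal K n := by
    intro f
    rw [← Ideal.mem_comap, Ideal.comap_map_of_surjective' _ Ideal.Quotient.mk_surjective, Ideal.mk_ker,
        sup_eq_left.2 hIP]
  have hB := h P' hP'
  let B := Localization.AtPrime P'
  let g : MvPolynomial (Fin n) K →+* B := (algebraMap _ B).comp q
  have hPg : (maxIdeal K n).map g = IsLocalRing.maximalIdeal B := by
    rw [← Ideal.map_map]
    exact Localization.AtPrime.map_eq_maximalIdeal
  have hdB : (F.card : WithBot ℕ∞) ≤ ringKrullDim B := by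
    rw [IsLocalization.AtPrime.ringKrullDim_eq_height P' B]
    have := height_ge hIF F disjoint_compl_right
    rw [union_compl, PF_univ] at this
    exact_mod_cast this
  have hD : Hm.D (maxIdeal K n) F.card I := by
    refine Hm.D.of_loc (B := B) (maxIdeal K n) I g ?_ ?_ le_rfl ?_
    · intro b
      obtain ⟨⟨a, s⟩, hs⟩ := IsLocalization.surj P'.primeCompl b
      obtain ⟨f, rfl⟩ := Ideal.Quotient.mk_surjective a
      exact ⟨_, f, IsLocalization.map_units _ s, hs⟩
    · intro Q hQ f
      have hcQ : ∀ f, q f ∈ Q.map q ↔ f ∈ Q := by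
        intro f
        rw [← Ideal.mem_comap, Ideal.comap_map_of_surjective' _ Ideal.Quotient.mk_surjective, Ideal.mk_ker,
          sup_eq_left.2 hQ]
      rw [← Ideal.map_map]
      show algebraMap _ B (q f) ∈ _ ↔ _
      rw [IsLocalization.algebraMap_mem_map_algebraMap_iff P'.primeCompl]
      constructor
      · rintro ⟨t, ht, htf⟩
        obtain ⟨t, rfl⟩ := Ideal.Quotient.mk_surjective t
        exact ⟨t, fun h => ht ((hc t).2 h), (hcQ _).1 (by rw [map_mul]; exact htf)⟩
      · rintro ⟨t, ht, htf⟩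
        exact ⟨q t, fun h => ht ((hc t).1 h), by rw [← map_mul]; exact (hcQ _).2 htf⟩
    · intro j hj
      have h1 := hB j (lt_of_lt_of_le (by exact_mod_cast hj) hdB)
      have h2 : I.map g = ⊥ := by
        rw [← Ideal.map_map, Ideal.map_quotient_self, Ideal.map_bot]
      rw [h2, hPg]
      apply Hm.W.of_bot
      rw [Hm.V_iff]
      exact h1
  exact hD.W_pow k i hi

end Cb

end

section

open Finset

namespace Cb
open MvPolynomial
variable {n : ℕ} {K : Type} [Field K] {Δ : SimComplex n} {m : ℕ}

/-- exponents in powers of the ideal generated by disjoint monomials -/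
def PT (T : Finset (Finset (Fin n))) (k : ℕ) (a : Fin n → ℕ) : Prop :=
  ∃ c : Finset (Fin n) → ℕ, k ≤ ∑ A ∈ T, c A ∧ ∀ A ∈ T, ∀ i ∈ A, c A ≤ a i

theorem Up.pt (T : Finset (Finset (Fin n))) (k : ℕ) : Up (PT T k) := by
  rintro a b hab ⟨c, hc, h⟩
  exact ⟨c, hc, fun A hA i hi => (h A hA i hi).trans (hab i)⟩

/-- indicator -/
noncomputable def i1 (A : Finset (Fin n)) : Fin n →₀ ℕ :=
  Finsupp.equivFunOnFinite.symm (fun i => if i ∈ A then 1 else 0)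

theorem i1_apply (A : Finset (Fin n)) (i : Fin n) : i1 A i = if i ∈ A then 1 else 0 := rfl

theorem PT.add {T : Finset (Finset (Fin n))} {k : ℕ} {A : Finset (Fin n)} (hA : A ∈ T) {b : Fin n →₀ ℕ}
    (h : PT T k b) : PT T (k+1) (i1 A + b : Fin n →₀ ℕ) := by
  classical
  obtain ⟨c, hc, h⟩ := h
  refine ⟨fun A' => if A' = A then c A + 1 else c A', ?_, ?_⟩
  · rw [← add_sum_erase _ _ hA] at hc ⊢
    rw [sum_congr rfl (g := fun x => c x) (fun x hx => by simp [ne_of_mem_erase hx])]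
    simp only [if_true]
    omega
  · intro A' hA' i hi
    have := h A' hA' i hi
    rw [Finsupp.add_apply, i1_apply]
    dsimp only
    by_cases e : A' = A
    · subst e; simp [hi]; omega
    · simp only [e, if_false]; omega

theorem PT.sub {T : Finset (Finset (Fin n))} (hT : ∀ A ∈ T, ∀ B ∈ T, A ≠ B → Disjoint A B) {k : ℕ}
    {A : Finset (Fin n)} (hA : A ∈ T) {b : Fin n →₀ ℕ}
    (h : PT T (k+1) (i1 A + b : Fin n →₀ ℕ)) : PT T k b := by
  classical
  obtain ⟨c, hc, h⟩ := h
  refine ⟨fun A' => if A' = A then c A - 1 else c A', ?_, ?_⟩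
  · rw [← add_sum_erase _ _ hA] at hc ⊢
    rw [sum_congr rfl (g := fun x => c x) (fun x hx => by simp [ne_of_mem_erase hx])]
    simp only [if_true]
    omega
  · intro A' hA' i hi
    have := h A' hA' i hi
    rw [Finsupp.add_apply, i1_apply] at this
    dsimp only
    by_cases e : A' = A
    · subst e; simp [hi] at this ⊢; omega
    · have : i ∉ A := disjoint_left.1 (hT A' hA' A hA e) hi
      simp_all

theorem PT.sub' {T : Finset (Finset (Fin n))} {k : ℕ}
    {A : Finset (Fin n)} (hT : ∀ B ∈ T, Disjoint A B) {b : Fin n →₀ ℕ}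
    (h : PT T k (i1 A + b : Fin n →₀ ℕ)) : PT T k b := by
  obtain ⟨c, hc, h⟩ := h
  refine ⟨c, hc, ?_⟩
  intro A' hA' i hi
  have := h A' hA' i hi
  rw [Finsupp.add_apply, i1_apply] at this
  have : i ∉ A := disjoint_right.1 (hT A' hA') hi
  simp_all

theorem J_pow {T : Finset (Finset (Fin n))} (hT : ∀ A ∈ T, ∀ B ∈ T, A ≠ B → Disjoint A B) (k : ℕ) :
    Hm.J (faceMonomial K) T ^ k = MI K (PT T k) := by
  classical
  induction k with
  | zero =>
    rw [pow_zero, Ideal.one_eq_top, eq_comm, Ideal.eq_top_iff_one]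
    exact (monomial_mem_MI (Up.pt T 0) (b := 0)).2 ⟨fun _ => 0, by simp, by simp⟩
  | succ k ih =>
    rw [pow_succ', ih]
    apply le_antisymm
    · rw [Ideal.mul_le]
      intro r hr s hs
      refine Submodule.span_induction ?_ ?_ ?_ ?_ hr
      · rintro _ ⟨A, hA, rfl⟩
        rw [faceMonomial_eq, monomial_mul_mem (Up.pt _ _)]
        intro b hb
        exact PT.add hA ((mem_MI (Up.pt _ _)).1 hs b hb)
      · simp
      · intro x y _ _ hx hy
        rw [add_mul]; exact add_mem hx hy
      · intro x y _ hy
        rw [smul_eq_mul, mul_assoc]; exact Ideal.mul_mem_left _ _ hy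
    · unfold MI
      rw [Ideal.span_le]
      rintro _ ⟨a, ha, rfl⟩
      have ha' : PT T (k+1) a := ha
      obtain ⟨c, hc, h⟩ := ha
      obtain ⟨A, hA, hcA⟩ : ∃ A ∈ T, c A ≠ 0 := by
        by_contra! hcon
        rw [sum_eq_zero hcon] at hc
        omega
      have hle : i1 A ≤ a := by
        intro i
        rw [i1_apply]
        split_ifs with hi
        · have := h A hA i hi; omega
        · omega
      obtain ⟨b, rfl⟩ := exists_add_of_le hle
      have e : monomial (i1 A + b) (1:K) = faceMonomial K A * monomial b 1 := by
        rw [faceMonomial_eq]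
        show _ = monomial (i1 A) (1:K) * _
        rw [monomial_mul, one_mul]
      dsimp only
      rw [SetLike.mem_coe, e]
      exact Ideal.mul_mem_mul (Ideal.subset_span ⟨A, hA, rfl⟩) (Ideal.subset_span ⟨b, PT.sub hT hA ha', rfl⟩)

theorem good {T0 : Finset (Finset (Fin n))} (hT0 : ∀ A ∈ T0, ∀ B ∈ T0, A ≠ B → Disjoint A B) :
    Hm.Good T0 (faceMonomial K) := by
  intro T hT A hA k g
  have hT' : ∀ A ∈ T, ∀ B ∈ T, A ≠ B → Disjoint A B := fun A hA B hB h => hT0 A (hT hA) B (hT hB) h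
  simp only [J_pow hT']
  rw [faceMonomial_eq, monomial_mul_mem (Up.pt _ _), monomial_mul_mem (Up.pt _ _), mem_MI (Up.pt _ _)]
  refine ⟨fun h1 h2 b hb => PT.sub hT' h1 (h2 b hb), fun h1 h2 b hb => PT.sub' (A := A) ?_ (h2 b hb)⟩
  intro B hB
  exact hT0 A hA B (hT hB) (fun h => h1 (h ▸ hB))

theorem SR_eq_J (Δ : SimComplex n) (hV : ∀ i, {i} ∈ Δ.faces) (hci : Δ.IsCompleteIntersection) :
    ∃ T0 : Finset (Finset (Fin n)), (∀ A ∈ T0, ∀ B ∈ T0, A ≠ B → Disjoint A B) ∧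
      SRIdeal K Δ = Hm.J (faceMonomial K) T0 := by
  classical
  refine ⟨univ.filter (fun A => Δ.IsMinNonface A), ?_, ?_⟩
  · intro A hA B hB h
    exact hci A B (by simpa using hA) (by simpa using hB) h
  · unfold SRIdeal Hm.J
    apply le_antisymm
    · rw [Ideal.span_le]
      rintro _ ⟨F, hF, rfl⟩
      obtain ⟨A, hAF, hA⟩ : ∃ A ⊆ F, Δ.IsMinNonface A := by
        induction F using Finset.strongInduction with
        | H F ih =>
          by_cases h : ∀ G ⊂ F, G ∈ Δ.faces
          · exact ⟨F, subset_rfl, fun i _ => hV i, hF, h⟩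
          · push Not at h
            obtain ⟨G, hG, hGf⟩ := h
            obtain ⟨A, hA, h⟩ := ih G hG hGf
            exact ⟨A, hA.trans hG.1, h⟩
      rw [SetLike.mem_coe]
      unfold faceMonomial
      rw [← prod_sdiff hAF]
      exact Ideal.mul_mem_left _ _ (Ideal.subset_span ⟨A, by simpa using hA, rfl⟩)
    · refine Ideal.span_mono ?_
      rintro _ ⟨A, hA, rfl⟩
      have : Δ.IsMinNonface A := by simpa using hA
      exact ⟨A, this.2.1, rfl⟩

end Cb

end

section

open Finset

namespace Cb
open MvPolynomial
variable {n : ℕ} {K : Type} [Field K] {Δ : SimComplex n} {m : ℕ}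

theorem D_PF (r : ℕ) : ∀ E : Finset (Fin n), E.card + r = n → Hm.D (maxIdeal K n) r (PF K E) := by
  classical
  induction r with
  | zero => intro _ _; trivial
  | succ r ih =>
    intro E hE
    obtain ⟨i, hi⟩ : ∃ i, i ∉ E := by
      by_contra! hcon
      have : E = univ := by ext i; simp [hcon i]
      rw [this, card_univ, Fintype.card_fin] at hE
      omega
    refine ⟨X i, X_mem_max i, fun f hf => ((PF_prime E).mem_or_mem hf).resolve_left (PF_lt hi), ?_⟩
    have : PF K E ⊔ Ideal.span {X i} = PF K (insert i E) := by
      unfold PF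
      rw [coe_insert, Set.image_insert_eq, Ideal.span_insert, sup_comm]
    rw [this]
    exact ih _ (by rw [card_insert_of_notMem hi]; omega)

theorem arith {d : WithBot ℕ∞} {i t r : ℕ} (hi : (i : WithBot ℕ∞) < d) (h : d + t ≤ r) : i + t < r := by
  have h1 : ((i : WithBot ℕ∞) + 1) ≤ d := by
    induction d using WithBot.recBotCoe with
    | bot => simp at hi
    | coe d =>
      have h0 : (i : ℕ∞) < d := by exact_mod_cast hi
      exact_mod_cast Order.add_one_le_of_lt h0
  have h2 := (add_le_add_left h1 (t : WithBot ℕ∞)).trans h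
  have h3 : i + 1 + t ≤ r := by exact_mod_cast h2
  omega

theorem ci_buchsbaum (hV : ∀ i, {i} ∈ Δ.faces) (hci : Δ.IsCompleteIntersection) (hm : m ≠ 0) :
    IsBuchsbaum K (SRIdeal K Δ ^ m) := by
  obtain ⟨T0, hT0, hJ⟩ := SR_eq_J (K := K) Δ hV hci
  have G := good (K := K) hT0
  apply isBuchsbaum_of_V
  intro i hi k
  have hD : Hm.D (maxIdeal K n) n ⊥ := by
    have := D_PF (K := K) n (∅ : Finset (Fin n)) (by simp)
    simpa [PF] using this
  rw [Hm.dim_pow _ _ hm] at hi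
  have hd := G.dim T0 subset_rfl
  rw [MvPolynomial.ringKrullDim_of_isNoetherianRing, ringKrullDim_eq_zero_of_field, ← hJ] at hd
  simp only [Nat.card_eq_fintype_card, Fintype.card_fin, zero_add] at hd
  have := G.W (hD.W_pow k) T0 subset_rfl m i (arith hi hd)
  rw [hJ]
  exact this


end Cb

namespace Hm
variable {ι : Type} [DecidableEq ι]

theorem cm_of_good {R B : Type} [CommRing R] [CommRing B] [IsRegularLocalRing R] [IsLocalRing B]
    (φ : R →+* B) (hφ : Function.Surjective φ) {T0 : Finset ι} {f : ι → R} (G : Good T0 f) {m : ℕ} (hm : m ≠ 0)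
    (hker : RingHom.ker φ = J f T0 ^ m) (i : ℕ) (hi : (i : WithBot ℕ∞) < ringKrullDim B) :
    V (ModuleCat.of B (B ⧸ IsLocalRing.maximalIdeal B)) i (ModuleCat.of B B) := by
  have hQ0 : (J f T0 ^ m).map φ = ⊥ := by
    rw [← hker, Ideal.map_eq_bot_iff_le_ker]
  have hmax : (IsLocalRing.maximalIdeal R).map φ = IsLocalRing.maximalIdeal B := by
    rcases Ideal.map_eq_top_or_isMaximal_of_surjective φ hφ (IsLocalRing.maximalIdeal.isMaximal R) with h | h
    · exfalso
      have h1 := congrArg (Ideal.comap φ) h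
      rw [Ideal.comap_map_of_surjective' _ hφ, Ideal.comap_top, sup_eq_left.2
        (IsLocalRing.le_maximalIdeal (RingHom.ker_ne_top φ))] at h1
      exact (IsLocalRing.maximalIdeal.isMaximal R).ne_top h1
    · exact IsLocalRing.eq_maximalIdeal h
  obtain ⟨r, hr, hDR⟩ := D.of_regular (R := R)
  have hdB : ringKrullDim B ≤ ringKrullDim (R ⧸ J f T0 ^ m) := by
    have h0 : ∀ a ∈ J f T0 ^ m, φ a = 0 := fun a ha => by
      rwa [← hker] at ha
    exact ringKrullDim_le_of_surjective (Ideal.Quotient.lift _ φ h0)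
      (Ideal.Quotient.lift_surjective_of_surjective _ _ hφ)
  rw [dim_pow _ _ hm] at hdB
  have hd := G.dim T0 subset_rfl
  rw [← hr] at hd
  have hlt : i + T0.card < r := Cb.arith (lt_of_lt_of_le hi hdB) hd
  have hDQ : D (IsLocalRing.maximalIdeal R) (i+1) (J f T0 ^ m) := by
    apply D.of_W
    intro j hj
    exact G.W hDR.W_one T0 subset_rfl m j (by omega)
  have hDB := D.map φ hφ hker.le hDQ
  rw [hQ0, hmax] at hDB
  exact (hDB.W_one i (by omega)).bot

theorem ker_loc {S : Type} [CommRing S] (I : Ideal S) (P' : Ideal (S ⧸ I)) [P'.IsPrime] :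
    RingHom.ker (Localization.localRingHom (P'.comap (Ideal.Quotient.mk I)) P' (Ideal.Quotient.mk I) rfl) =
      I.map (algebraMap S (Localization.AtPrime (P'.comap (Ideal.Quotient.mk I)))) := by
  apply le_antisymm
  · intro x hx
    obtain ⟨⟨a, s⟩, rfl⟩ := IsLocalization.mk'_surjective (P'.comap (Ideal.Quotient.mk I)).primeCompl x
    rw [RingHom.mem_ker] at hx
    dsimp only at hx
    rw [IsLocalization.mk'_mem_map_algebraMap_iff (P'.comap (Ideal.Quotient.mk I)).primeCompl]
    have h0 : algebraMap _ (Localization.AtPrime P') (Ideal.Quotient.mk I a) = 0 := by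
      rw [← Localization.localRingHom_to_map (P'.comap (Ideal.Quotient.mk I)) P' (Ideal.Quotient.mk I) rfl,
        ← IsLocalization.mk'_spec _ a s, map_mul, hx, zero_mul]
    obtain ⟨t, ht⟩ := (IsLocalization.map_eq_zero_iff P'.primeCompl _ _).1 h0
    obtain ⟨t', ht'⟩ := Ideal.Quotient.mk_surjective t.1
    refine ⟨t', fun h => t.2 ?_, ?_⟩
    · rw [← ht']; exact h
    · rw [← ht', ← map_mul] at ht
      exact Ideal.Quotient.eq_zero_iff_mem.1 ht
  · rw [Ideal.map_le_iff_le_comap]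
    intro a ha
    rw [Ideal.mem_comap, RingHom.mem_ker, Localization.localRingHom_to_map, Ideal.Quotient.eq_zero_iff_mem.2 ha, map_zero]

theorem cm_loc {S : Type} [CommRing S] [IsRegularRing S] {T0 : Finset ι} {f : ι → S} (G : Good T0 f) {m : ℕ}
    (hm : m ≠ 0) : IsCohenMacaulayIdeal (J f T0 ^ m) := by
  intro P' hP'
  intro i hi
  have := cm_of_good (R := Localization.AtPrime (P'.comap (Ideal.Quotient.mk (J f T0 ^ m)))) _
    (RingHom.surjective_localRingHom_of_surjective (Ideal.Quotient.mk (J f T0 ^ m)) Ideal.Quotient.mk_surjective P')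
    (G.loc (P'.comap (Ideal.Quotient.mk (J f T0 ^ m))).primeCompl _) hm (by rw [ker_loc, J_map]) i hi
  rw [V_iff] at this
  exact this

end Hm

namespace Cb
open MvPolynomial
variable {n : ℕ} {K : Type} [Field K] {Δ : SimComplex n} {m : ℕ}

theorem ci_cm (hV : ∀ i, {i} ∈ Δ.faces) (hci : Δ.IsCompleteIntersection) (hm : m ≠ 0) :
    IsCohenMacaulayIdeal (SRIdeal K Δ ^ m) := by
  obtain ⟨T0, hT0, hJ⟩ := SR_eq_J (K := K) Δ hV hci
  rw [hJ]
  exact Hm.cm_loc (good (K := K) hT0) hm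

end Cb

end

/-- **Theorem.** For `dim Δ ≥ 2`: all ordinary powers of `I_Δ` are Cohen–Macaulay iff
some `I_Δ^m`, `m ≥ 3`, is Buchsbaum iff some `I_Δ^m`, `m ≥ 3`, is quasi-Buchsbaum iff
`Δ` is a complete intersection. -/
theorem ordinary_powers_Buchsbaum_iff_CI (K : Type) [Field K] {n : ℕ}
    (Δ : SimComplex n)
    (hV : ∀ i : Fin n, ({i} : Finset (Fin n)) ∈ Δ.faces) (hdim : 2 ≤ Δ.dim) :
    List.TFAE
      [∀ m : ℕ, 1 ≤ m → IsCohenMacaulayIdeal (SRIdeal K Δ ^ m),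
       ∃ m : ℕ, 3 ≤ m ∧ IsBuchsbaum K (SRIdeal K Δ ^ m),
       ∃ m : ℕ, 3 ≤ m ∧ IsQuasiBuchsbaum K (SRIdeal K Δ ^ m),
       Δ.IsCompleteIntersection] := by
  tfae_have 1 → 4 := fun h => Cb.cm_ci (K := K) Δ hV hdim (le_refl 3) (h 3 (by omega))
  tfae_have 4 → 1 := fun h m hm => Cb.ci_cm hV h (by omega)
  tfae_have 4 → 2 := fun h => ⟨3, le_refl 3, Cb.ci_buchsbaum hV h (by omega)⟩
  tfae_have 2 → 3 := fun ⟨m, hm, h⟩ => ⟨m, hm, h.quasi⟩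
  tfae_have 3 → 4 := fun ⟨m, hm, h⟩ => Cb.qb_ci (K := K) Δ hV hdim hm h
  tfae_finish
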